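/- Convergence of the scaled Gaussian input (Lemma 3, heavy traffic). Assume that r_i(u) → 0 as u → ∞ for every i ∈ {1,…,n} and that the model satisfies H1, H2, N1, N2 and N3. Then, for every T > 0, the n-dimensional process Jᵟ_u(·) = (J(δ(r_1(u))·)/σ(δ(r_1(u))), …, J(δ(r_n(u))·)/σ(δ(r_n(u))))ᵀ converges in distribution in C([−T,T] → ℝⁿ), as u → ∞, to B_α(·). -/

import Mathlib

open MeasureTheory ProbabilityTheory Filter Topology

noncomputable section

/-- Covariance function of a centered Gaussian process with stationary increments
and standard deviation function `σ`:
`Cov(J(t), J(s)) = (σ²(|t|) + σ²(|s|) − σ²(|t−s|))/2`. -/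
def covFromStd (σ : ℝ → ℝ) : ℝ → ℝ → ℝ := fun t s =>
  (σ |t| ^ 2 + σ |s| ^ 2 - σ |t - s| ^ 2) / 2

/-- `X` is a real-valued centered Gaussian process (indexed by `ℝ`) with covariance
function `K`, under the measure `P`: every finite linear combination of its values is a
centered Gaussian real random variable with the variance prescribed by `K`. -/
def IsCenteredGaussian1 {Ω : Type*} [MeasurableSpace Ω] (P : Measure Ω)
    (X : ℝ → Ω → ℝ) (K : ℝ → ℝ → ℝ) : Prop :=
  (∀ t, Measurable (X t)) ∧
  ∀ (k : ℕ) (t : Fin k → ℝ) (c : Fin k → ℝ),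
    P.map (fun ω => ∑ a, c a * X (t a) ω)
      = gaussianReal 0 (∑ a, ∑ b, c a * c b * K (t a) (t b)).toNNReal

/-- `X` is an `n`-dimensional centered Gaussian process with matrix covariance function
`K` (`K i j t s = Cov(Xᵢ(t), Xⱼ(s))`) under the measure `P`. -/
def IsCenteredGaussianVec {Ω : Type*} [MeasurableSpace Ω] {n : ℕ} (P : Measure Ω)
    (X : ℝ → Ω → Fin n → ℝ) (K : Fin n → Fin n → ℝ → ℝ → ℝ) : Prop :=
  (∀ t i, Measurable fun ω => X t ω i) ∧
  ∀ (k : ℕ) (t : Fin k → ℝ) (c : Fin k → Fin n → ℝ),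
    P.map (fun ω => ∑ a, ∑ i, c a i * X (t a) ω i)
      = gaussianReal 0
          (∑ a, ∑ b, ∑ i, ∑ j, c a i * c b j * K i j (t a) (t b)).toNNReal

/-- Covariance of the limiting fractional-Brownian-type process with Hurst-type
parameter `h` and rate ratio `ρv`; the exponent `1/(h−1)` equals `−κ` in the
light-traffic case (`h = λ`, `κ = (1−λ)⁻¹`) and `ξ` in the heavy-traffic case (`h = α`). -/
def limCov (h ρv t s : ℝ) : ℝ :=
  if 0 < ρv then
    (|t| ^ (2 * h) + |ρv ^ (1 / (h - 1)) * s| ^ (2 * h)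
        - |t - ρv ^ (1 / (h - 1)) * s| ^ (2 * h)) / (2 * ρv ^ (1 / (h - 1) * h))
  else 0

/-- Matrix covariance function of the limiting `n`-dimensional Gaussian process `B`. -/
def limCovMat {n : ℕ} (h : ℝ) (ρ : Fin n → Fin n → ℝ) (i j : Fin n) (t s : ℝ) : ℝ :=
  if i ≤ j then limCov h (ρ i j) t s else limCov h (ρ j i) s t

/-- The stationary reflected (workload) map:
`X̄(t) = sup_{−∞ < s < t} (c (J(t) − J(s)) − rate (t − s))`. -/
def XbarProc {Ω : Type*} (J : ℝ → Ω → ℝ) (c rate t : ℝ) (ω : Ω) : ℝ :=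
  ⨆ s : Set.Iio t, (c * (J t ω - J (↑s) ω) - rate * (t - ↑s))

/-- Convergence in distribution, as `u → ∞`, of the processes `X u` (on `(Ω, P)`) to `Y`
(on `(Ω', P')`), viewed as random elements of the space of functions on `I` carrying the
topology of uniform convergence on compact subsets of `I`: the expectations of every
bounded continuous functional converge. -/
def TendstoInDistOnCompacts {Ω Ω' : Type*} [MeasurableSpace Ω] [MeasurableSpace Ω']
    (P : Measure Ω) (P' : Measure Ω') (I : Set ℝ) (n : ℕ)
    (X : ℝ → Ω → ℝ → Fin n → ℝ) (Y : Ω' → ℝ → Fin n → ℝ) : Prop :=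
  ∀ F : BoundedContinuousFunction
      (UniformOnFun ↥I (Fin n → ℝ) {K : Set ↥I | IsCompact K}) ℝ,
    Tendsto
      (fun u => ∫ ω, F (UniformOnFun.ofFun {K : Set ↥I | IsCompact K}
          (fun t : ↥I => X u ω ↑t)) ∂P)
      atTop
      (𝓝 (∫ ω, F (UniformOnFun.ofFun {K : Set ↥I | IsCompact K}
          (fun t : ↥I => Y ω ↑t)) ∂P'))


structure StdFun (S : ℝ → ℝ) (α : ℝ) : Prop where
  hα0 : 0 < α
  hα1 : α < 1
  cont : Continuous S
  zero : S 0 = 0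
  pos : ∀ x, x ≠ 0 → 0 < S x
  even : ∀ x, S (-x) = S x
  cs : ∀ x y z w, |S (x - w) ^ 2 + S (y - z) ^ 2 - S (x - z) ^ 2 - S (y - w) ^ 2|
    ≤ 2 * S (x - y) * S (z - w)
  rv : ∀ t > (0:ℝ), Tendsto (fun x => S (t * x) / S x) atTop (𝓝 (t ^ α))
  holder : ∃ t₀ β C : ℝ, 0 < t₀ ∧ 0 < β ∧ 0 < C ∧ ∀ t, 0 < t → t < t₀ → S t ≤ C * t ^ β

namespace StdFun
variable {S : ℝ → ℝ} {α : ℝ}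

lemma nonneg (h : StdFun S α) (x : ℝ) : 0 ≤ S x := by
  by_cases hx : x = 0
  · rw [hx, h.zero]
  · exact (h.pos x hx).le

lemma sub (h : StdFun S α) (x y : ℝ) : S (x + y) ≤ S x + S y := by
  have h1 := h.cs x 0 0 (-y)
  simp only [sub_neg_eq_add, sub_zero, zero_add, h.zero] at h1
  have h2 := (abs_le.mp h1).2
  have := h.nonneg x
  have := h.nonneg y
  apply le_of_sq_le_sq _ (by positivity)
  nlinarith

lemma abs_sub_le (h : StdFun S α) (x y : ℝ) : |S x - S y| ≤ S (x - y) := by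
  rw [abs_le]
  have h1 := h.sub (x - y) y
  have h2 := h.sub (y - x) x
  have h3 := h.even (x - y)
  simp only [sub_add_cancel, neg_sub] at h1 h2 h3
  constructor <;> linarith

lemma natmul (h : StdFun S α) (k : ℕ) (x : ℝ) : S (k * x) ≤ k * S x := by
  induction k with
  | zero => simp [h.zero]
  | succ k ih =>
    have := h.sub (k * x) x
    push_cast
    rw [add_mul, one_mul, add_mul, one_mul]
    linarith

lemma abs_eq (h : StdFun S α) (x : ℝ) : S |x| = S x := by
  rcases abs_cases x with ⟨h1, _⟩ | ⟨h1, _⟩ <;> rw [h1]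
  exact h.even x

/-- dyadic Potter-type bound -/
lemma dyadic (h : StdFun S α) : ∃ q A X : ℝ, 0 < q ∧ q < 1 ∧ 0 < A ∧ 0 < X ∧
    ∀ k : ℕ, ∀ x ≥ X, S (x / 2 ^ k) ≤ A * q ^ k * S x := by
  obtain ⟨t₀, β, C, ht₀, hβ, hC, hH⟩ := h.holder
  have hα := h.hα0
  set q0 : ℝ := max ((1/2:ℝ) ^ α) ((1/2:ℝ) ^ β) with hq0
  have hq0l : q0 < 1 := by
    rw [hq0, max_lt_iff]
    exact ⟨Real.rpow_lt_one (by norm_num) (by norm_num) hα,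
      Real.rpow_lt_one (by norm_num) (by norm_num) hβ⟩
  have hq0p : 0 < q0 := lt_max_of_lt_left (by positivity)
  obtain ⟨q, hq1, hq2⟩ := exists_between hq0l
  have hqp : 0 < q := hq0p.trans hq1
  have hrv := (h.rv (1/2) (by norm_num)).eventually_lt_const
    (lt_of_le_of_lt (le_max_left _ _) hq1)
  obtain ⟨X0, hX0⟩ := (hrv.and (eventually_gt_atTop 0)).exists_forall_of_atTop
  set X := max X0 1 with hX
  have hXp : 0 < X := by positivity
  have hhalf : ∀ x ≥ X, S (x / 2) ≤ q * S x := by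
    intro x hx
    have hx0 : 0 < x := hXp.trans_le hx
    have := (hX0 x ((le_max_left _ _).trans hx)).1
    rw [div_lt_iff₀ (h.pos x hx0.ne')] at this
    rw [show x / 2 = 1 / 2 * x by ring]
    exact this.le
  -- upper bound near zero
  obtain ⟨M, hM⟩ := (isCompact_Icc (a := (0:ℝ)) (b := X)).exists_bound_of_continuousOn
    h.cont.continuousOn
  have hM0 : 0 ≤ M := (norm_nonneg _).trans (hM 0 ⟨le_rfl, hXp.le⟩)
  have hC1 : ∃ C1 > 0, ∀ z, 0 < z → z ≤ X → S z ≤ C1 * z ^ β := by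
    refine ⟨C + M / t₀ ^ β, by positivity, ?_⟩
    intro z hz hzX
    by_cases hzt : z < t₀
    · refine (hH z hz hzt).trans ?_
      gcongr
      have : 0 ≤ M / t₀ ^ β := by positivity
      linarith
    · have h1 := hM z ⟨hz.le, hzX⟩
      have h2 : t₀ ^ β ≤ z ^ β := Real.rpow_le_rpow ht₀.le (not_lt.mp hzt) hβ.le
      have h3 : 0 < t₀ ^ β := by positivity
      calc S z ≤ M := (le_abs_self _).trans h1
        _ = M / t₀ ^ β * t₀ ^ β := by field_simp
        _ ≤ M / t₀ ^ β * z ^ β := by gcongr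
        _ ≤ _ := by
          have : 0 ≤ z ^ β := by positivity
          nlinarith
  obtain ⟨C1, hC1p, hC1⟩ := hC1
  have hA1 : ∀ k : ℕ, ∀ y, 0 < y → y ≤ X → S (y / 2 ^ k) ≤ C1 * X ^ β * q ^ k := by
    intro k y hy hyX
    have h1 := hC1 (y / 2 ^ k) (by positivity)
      ((div_le_self hy.le (one_le_pow₀ (by norm_num))).trans hyX)
    refine h1.trans ?_
    rw [Real.div_rpow hy.le (by positivity), mul_assoc]
    gcongr
    rw [div_eq_mul_inv]
    gcongr
    rw [← Real.rpow_natCast, ← Real.rpow_mul (by norm_num), mul_comm (k:ℝ) β,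
      Real.rpow_mul (by norm_num), Real.rpow_natCast, ← inv_pow]
    gcongr
    refine le_trans ?_ hq1.le
    refine le_trans (le_of_eq ?_) (le_max_right _ _)
    rw [one_div, Real.inv_rpow (by norm_num)]
  -- lower bound on [X/2, X]
  obtain ⟨x1, hx1, hx1min⟩ := (isCompact_Icc (a := X/2) (b := X)).exists_isMinOn
    ⟨X, by constructor <;> linarith⟩ h.cont.continuousOn
  have hc : 0 < S x1 := h.pos x1 (by have := hx1.1; intro h0; linarith)
  have hmin : ∀ x, X/2 ≤ x → x ≤ X → S x1 ≤ S x := fun x h1 h2 => hx1min ⟨h1, h2⟩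
  set A := max 1 (C1 * X ^ β / S x1) with hA
  have hAp : 0 < A := by positivity
  refine ⟨q, A, X, hqp, hq2, hAp, hXp, ?_⟩
  have key : ∀ k : ℕ, ∀ x ≥ X/2, S (x / 2 ^ k) ≤ A * q ^ k * S x := by
    intro k
    induction k with
    | zero =>
      intro x hx
      have := h.nonneg x
      have : 1 ≤ A := le_max_left _ _
      simp
      nlinarith
    | succ k ih =>
      intro x hx
      by_cases hxX : X ≤ x
      · have h1 := ih (x/2) (by linarith)
        rw [div_div, ← pow_succ'] at h1
        refine h1.trans ?_
        have := hhalf x hxX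
        rw [pow_succ q, mul_assoc, mul_assoc A, mul_assoc (q^k)]
        gcongr
      · have h1 := hA1 (k+1) x (by linarith) (not_le.mp hxX).le
        refine h1.trans ?_
        have h2 := hmin x hx (not_le.mp hxX).le
        calc C1 * X ^ β * q ^ (k+1) = (C1 * X ^ β / S x1) * q ^ (k+1) * S x1 := by field_simp
          _ ≤ A * q ^ (k+1) * S x := by
            gcongr
            exact le_max_right _ _
  intro k x hx
  exact key k x (by linarith)

lemma chain (h : StdFun S α) (x : ℝ) (hx : 0 ≤ x) (N k : ℕ) :
    ∀ y, 0 ≤ y → y ≤ x / 2 ^ k → ∃ z, 0 ≤ z ∧ z ≤ x / 2 ^ (k + N) ∧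
      S y ≤ ∑ l ∈ Finset.range N, S (x / 2 ^ (k + l + 1)) + S z := by
  induction N with
  | zero => intro y h1 h2; exact ⟨y, h1, by simpa using h2, by simp⟩
  | succ N ih =>
    intro y h1 h2
    obtain ⟨z, hz1, hz2, hz3⟩ := ih y h1 h2
    set w := x / 2 ^ (k + N + 1) with hw
    have hw0 : 0 ≤ w := by positivity
    have hw2 : x / 2 ^ (k + N) = 2 * w := by rw [hw, pow_succ]; field_simp
    rw [← add_assoc, ← hw, Finset.sum_range_succ, ← hw]
    by_cases hzw : z ≤ w
    · exact ⟨z, hz1, hzw, by have := h.nonneg w; linarith⟩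
    · refine ⟨z - w, by linarith, by linarith, ?_⟩
      have := h.sub w (z - w)
      simp only [add_sub_cancel] at this
      linarith

lemma unif (h : StdFun S α) : ∃ q A X : ℝ, 0 < q ∧ q < 1 ∧ 0 < A ∧ 0 < X ∧
    ∀ k : ℕ, ∀ x ≥ X, ∀ y, |y| ≤ x / 2 ^ k → S y ≤ A * q ^ k * S x := by
  obtain ⟨q, A, X, hq, hq1, hA, hX, H⟩ := h.dyadic
  refine ⟨q, A / (1 - q) + 1, X, hq, hq1, by have : 0 < 1 - q := by linarith
                                             positivity, hX, ?_⟩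
  intro k x hx y hy
  have hx0 : 0 < x := hX.trans_le hx
  have hSx := h.pos x hx0.ne'
  have hlim : ∀ᶠ z in 𝓝 (0:ℝ), S z < q ^ k * S x := by
    have : Tendsto S (𝓝 0) (𝓝 (S 0)) := h.cont.tendsto 0
    rw [h.zero] at this
    exact this.eventually_lt_const (by positivity)
  obtain ⟨ε, hε, hε2⟩ := Metric.eventually_nhds_iff.mp hlim
  obtain ⟨N, hN⟩ := exists_pow_lt_of_lt_one (show 0 < ε / x by positivity)
    (show (1/2:ℝ) < 1 by norm_num)
  obtain ⟨z, hz1, hz2, hz3⟩ := h.chain x hx0.le N k |y| (abs_nonneg y) hy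
  rw [h.abs_eq] at hz3
  have hz : S z < q ^ k * S x := by
    apply hε2
    rw [Real.dist_eq, sub_zero, abs_of_nonneg hz1]
    refine hz2.trans_lt ?_
    rw [lt_div_iff₀ hx0] at hN
    refine lt_of_le_of_lt ?_ hN
    rw [one_div, inv_pow, mul_comm, div_eq_mul_inv]
    gcongr
    · norm_num
    · omega
  have hsum : ∑ l ∈ Finset.range N, S (x / 2 ^ (k + l + 1)) ≤ A / (1 - q) * q ^ k * S x := by
    calc _ ≤ ∑ l ∈ Finset.range N, A * q ^ k * S x * q ^ l := by
          gcongr with l hl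
          refine (H (k + l + 1) x hx).trans ?_
          rw [pow_add, pow_add, pow_one]
          have : 0 ≤ A * q ^ k * S x * q ^ l := by positivity
          nlinarith
      _ = A * q ^ k * S x * ∑ l ∈ Finset.range N, q ^ l := by rw [Finset.mul_sum]
      _ ≤ A * q ^ k * S x * (1 / (1 - q)) := by
          gcongr
          rw [geom_sum_eq hq1.ne, ← neg_div_neg_eq]
          have : 0 < 1 - q := by linarith
          have : 0 < q ^ N := by positivity
          rw [neg_sub, neg_sub]
          gcongr
          linarith
      _ = _ := by ring
  calc S y ≤ _ := hz3
    _ ≤ A / (1 - q) * q ^ k * S x + q ^ k * S x := by linarith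
    _ = _ := by ring

lemma tendsto_zero (h : StdFun S α) {ι : Type*} {l : Filter ι} {d y : ι → ℝ}
    (hd : Tendsto d l atTop) (hy : Tendsto y l (𝓝 0)) :
    Tendsto (fun i => S (d i * y i) / S (d i)) l (𝓝 0) := by
  obtain ⟨q, A, X, hq, hq1, hA, hX, H⟩ := h.unif
  rw [Metric.tendsto_nhds]
  intro ε hε
  obtain ⟨k, hk⟩ := exists_pow_lt_of_lt_one (show 0 < ε / A by positivity) hq1
  have h1 : ∀ᶠ i in l, |y i| < 1 / 2 ^ k := by
    have := hy.abs
    rw [abs_zero] at this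
    exact this.eventually_lt_const (by positivity)
  filter_upwards [h1, hd.eventually_ge_atTop X] with i hi1 hi2
  have hdp : 0 < d i := hX.trans_le hi2
  have hS := h.pos _ hdp.ne'
  have := H k (d i) hi2 (d i * y i) (by
    rw [abs_mul, abs_of_pos hdp, div_eq_mul_one_div]; gcongr)
  rw [Real.dist_eq, sub_zero, abs_of_nonneg (div_nonneg (h.nonneg _) hS.le), div_lt_iff₀ hS]
  refine this.trans_lt ?_
  gcongr
  rw [lt_div_iff₀ hA] at hk
  linarith

lemma tendsto_rv (h : StdFun S α) {ι : Type*} {l : Filter ι} {d y : ι → ℝ} {y0 : ℝ}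
    (hd : Tendsto d l atTop) (hy : Tendsto y l (𝓝 y0)) :
    Tendsto (fun i => S (d i * y i) / S (d i)) l (𝓝 (|y0| ^ α)) := by
  have h0 : Tendsto (fun i => S (d i * y0) / S (d i)) l (𝓝 (|y0| ^ α)) := by
    by_cases hy0 : y0 = 0
    · simp only [hy0, mul_zero, h.zero, zero_div, abs_zero, Real.zero_rpow h.hα0.ne']
      exact tendsto_const_nhds
    · have := (h.rv |y0| (abs_pos.mpr hy0)).comp hd
      refine this.congr' ?_
      filter_upwards [hd.eventually_gt_atTop 0] with i hi
      simp only [Function.comp]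
      rw [← h.abs_eq (d i * y0), abs_mul, abs_of_pos hi, mul_comm]
  have h1 := h.tendsto_zero hd (y := fun i => y i - y0) (by simpa using hy.sub_const y0)
  have h2 : Tendsto (fun i => S (d i * y i) / S (d i) - S (d i * y0) / S (d i)) l (𝓝 0) := by
    refine squeeze_zero_norm (fun i => ?_) h1
    rw [← sub_div, norm_div, Real.norm_eq_abs, Real.norm_eq_abs, abs_of_nonneg (h.nonneg (d i)),
      mul_sub]
    exact div_le_div_of_nonneg_right (h.abs_sub_le _ _) (h.nonneg _)
  simpa using h2.add h0

end StdFun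

namespace StdFun
variable {S : ℝ → ℝ} {α : ℝ} {ι : Type*} {l : Filter ι} {r d e : ι → ℝ}

lemma tendsto_scale (h : StdFun S α) (hr : Tendsto r l (𝓝 0)) (hd : ∀ᶠ i in l, 0 < d i)
    (hrd : ∀ᶠ i in l, r i * d i = S (d i)) : Tendsto d l atTop := by
  rw [tendsto_atTop]
  intro M0
  set M := max M0 1
  have hM : 0 < M := by positivity
  obtain ⟨x1, hx1, hx1min⟩ := (isCompact_Icc (a := M) (b := 2 * M)).exists_isMinOn
    ⟨M, by constructor <;> linarith⟩ h.cont.continuousOn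
  have hc : 0 < S x1 := h.pos x1 (by have := hx1.1; intro h0; linarith)
  filter_upwards [hd, hrd, hr.eventually_lt_const (show 0 < S x1 / (2 * M) by positivity)]
    with i h1 h2 h3
  by_contra hcon
  have hdM : d i ≤ M := (not_le.mp hcon).le.trans (le_max_left _ _)
  set k := ⌈M / d i⌉₊ with hk
  have hk1 : M / d i ≤ k := Nat.le_ceil _
  have hk2 : (k:ℝ) < M / d i + 1 := Nat.ceil_lt_add_one (by positivity)
  have hk1' : M ≤ k * d i := by rwa [div_le_iff₀ h1] at hk1
  have hk2' : k * d i ≤ 2 * M := by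
    have : k * d i ≤ (M / d i + 1) * d i := by gcongr
    rw [add_mul, div_mul_cancel₀ _ h1.ne'] at this
    linarith
  have h4 : S x1 ≤ S (k * d i) := hx1min ⟨hk1', hk2'⟩
  have h5 := h.natmul k (d i)
  rw [← h2] at h5
  rw [lt_div_iff₀ (by positivity)] at h3
  have hk0 : 0 < k * d i := by linarith
  have hri : 0 < r i := by
    have := h.pos (d i) h1.ne'
    rw [← h2] at this
    exact pos_of_mul_pos_left this h1.le
  nlinarith

lemma bdd_ratio (h : StdFun S α) {ρ : ℝ} (hρ : 0 < ρ) (hd : Tendsto d l atTop)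
    (he : ∀ᶠ i in l, 0 < e i)
    (hR : Tendsto (fun i => (S (e i) / S (d i)) / (e i / d i)) l (𝓝 ρ)) :
    ∃ m : ℝ, 0 < m ∧ ∀ᶠ i in l, e i / d i ≤ m := by
  obtain ⟨q, A, X, hq, hq1, hA, hX, H⟩ := h.unif
  have hα1 := h.hα1
  have hlim : Tendsto (fun m : ℕ => (m:ℝ) ^ (-(1 - α))) atTop (𝓝 0) :=
    (tendsto_rpow_neg_atTop (by linarith)).comp tendsto_natCast_atTop_atTop
  obtain ⟨m, hm, hm1⟩ := ((hlim.eventually_lt_const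
    (show 0 < ρ / 2 / (2 * (1 + A)) by positivity)).and (eventually_ge_atTop 1)).exists
  have hm0 : (0:ℝ) < m := by exact_mod_cast hm1
  have hm1' : (1:ℝ) ≤ m := by exact_mod_cast hm1
  refine ⟨m, hm0, ?_⟩
  have h2 : ∀ᶠ i in l, S (m * d i) / S (d i) < 2 * (m:ℝ) ^ α := by
    have := (h.rv m hm0).comp hd
    have hp : (0:ℝ) < (m:ℝ) ^ α := by positivity
    exact this.eventually_lt_const (by linarith)
  filter_upwards [hd.eventually_ge_atTop X, he, h2, hR.eventually_const_lt
    (show ρ / 2 < ρ by linarith)] with i hi1 hi2 hi3 hi4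
  by_contra hcon
  have hdp : 0 < d i := hX.trans_le hi1
  have hSd := h.pos _ hdp.ne'
  have hcon : m < e i / d i := not_le.mp hcon
  have hmd : 0 < m * d i := by positivity
  have hSm := h.pos _ hmd.ne'
  have hw1 : 1 < e i / (m * d i) := by
    rw [lt_div_iff₀ hdp] at hcon
    rw [lt_div_iff₀ hmd]; linarith
  set w := e i / (m * d i) with hw
  set j := ⌊w⌋₊ with hj
  have hj1 : (j:ℝ) ≤ w := Nat.floor_le (by linarith)
  have hj2 : w < j + 1 := Nat.lt_floor_add_one w
  have hew : e i = w * (m * d i) := by rw [hw]; field_simp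
  have h5 := h.sub (j * (m * d i)) (e i - j * (m * d i))
  rw [add_sub_cancel] at h5
  have h6 := h.natmul j (m * d i)
  have h7 := H 0 (m * d i) (by nlinarith) (e i - j * (m * d i)) (by
    rw [pow_zero, div_one, hew, ← sub_mul, abs_of_nonneg (mul_nonneg (by linarith) hmd.le)]
    nlinarith)
  rw [pow_zero, mul_one] at h7
  have h8 : S (e i) ≤ (1 + A) * w * S (m * d i) := by nlinarith [mul_pos hA hSm]
  rw [div_lt_iff₀ hSd] at hi3
  have h9 : S (e i) / S (d i) / (e i / d i) ≤ (1 + A) * (2 * (m:ℝ) ^ α) / m := by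
    rw [div_div, div_le_div_iff₀ (by positivity) hm0]
    calc S (e i) * m ≤ (1 + A) * w * (2 * (m:ℝ) ^ α * S (d i)) * m := by
          gcongr
          refine h8.trans ?_
          gcongr
      _ = _ := by rw [hew]; field_simp
  have h10 : (m:ℝ) ^ (-(1 - α)) = (m:ℝ) ^ α / m := by
    rw [neg_sub, Real.rpow_sub hm0, Real.rpow_one]
  rw [h10, lt_div_iff₀ (by positivity)] at hm
  have : (1 + A) * (2 * (m:ℝ) ^ α) / m = (m:ℝ) ^ α / m * (2 * (1 + A)) := by ring
  linarith

lemma ratio_tendsto (h : StdFun S α) {ρ : ℝ} (hρ : 0 < ρ) (hd : Tendsto d l atTop)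
    (he : Tendsto e l atTop)
    (hR : Tendsto (fun i => (S (e i) / S (d i)) / (e i / d i)) l (𝓝 ρ)) :
    Tendsto (fun i => e i / d i) l (𝓝 (ρ ^ (1 / (α - 1)))) := by
  obtain ⟨b, hb, hb2⟩ := h.bdd_ratio hρ hd (he.eventually_gt_atTop 0) hR
  obtain ⟨a, ha, ha2⟩ := h.bdd_ratio (inv_pos.mpr hρ) he (hd.eventually_gt_atTop 0) (by
    refine (hR.inv₀ hρ.ne').congr fun i => ?_
    rw [inv_div, div_div_eq_mul_div, div_div_eq_mul_div]
    ring)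
  rw [tendsto_iff_ultrafilter]
  intro U hU
  have hmem : ∀ᶠ i in (U : Filter ι), e i / d i ∈ Set.Icc a⁻¹ b := by
    apply hU
    filter_upwards [hb2, ha2, he.eventually_gt_atTop 0, hd.eventually_gt_atTop 0]
      with i h1 h2 h3 h4
    refine ⟨?_, h1⟩
    rw [← inv_div]
    exact inv_anti₀ (by positivity) h2
  obtain ⟨q0, hq0, hq0'⟩ := (isCompact_Icc (a := a⁻¹) (b := b)).ultrafilter_le_nhds
    (U.map (fun i => e i / d i)) (by
      rw [le_principal_iff]; exact hmem)
  have hq : Tendsto (fun i => e i / d i) U (𝓝 q0) := hq0'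
  have hq0p : 0 < q0 := (inv_pos.mpr ha).trans_le hq0.1
  have h1 := (h.tendsto_rv (hd.mono_left hU) hq).div hq hq0p.ne'
  have h2 : |q0| ^ α / q0 = ρ := by
    refine tendsto_nhds_unique h1 ((hR.mono_left hU).congr' ?_)
    filter_upwards [hU (hd.eventually_gt_atTop 0)] with i hi
    simp only [Pi.div_apply]
    rw [mul_div_cancel₀ _ hi.ne']
  have h3 : ρ ^ (1 / (α - 1)) = q0 := by
    rw [← h2, abs_of_pos hq0p]
    rw [← Real.rpow_sub_one hq0p.ne', ← Real.rpow_mul hq0p.le,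
      mul_one_div_cancel (by have := h.hα1; intro h0; linarith), Real.rpow_one]
  rw [h3]; exact hq

lemma ratio_tendsto_zero (h : StdFun S α) (hd : Tendsto d l atTop)
    (he : Tendsto e l atTop)
    (hR : Tendsto (fun i => (S (e i) / S (d i)) / (e i / d i)) l (𝓝 0)) :
    Tendsto (fun i => d i / e i) l (𝓝 0) := by
  obtain ⟨q, A, X, hq, hq1, hA, hX, H⟩ := h.unif
  have hR2 := hR.const_mul (2 * A)
  rw [mul_zero] at hR2
  refine squeeze_zero' ?_ ?_ hR2
  · filter_upwards [he.eventually_gt_atTop 0, hd.eventually_gt_atTop 0] with i h1 h2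
    positivity
  filter_upwards [he.eventually_gt_atTop 0, hd.eventually_ge_atTop X, 
    hR2.eventually_lt_const one_pos] with i he0 hdX hlt
  have hd0 : 0 < d i := hX.trans_le hdX
  have hSd := h.pos _ hd0.ne'
  have hSe := h.pos _ he0.ne'
  set k := ⌈d i / e i⌉₊ with hk
  have hk1 : d i / e i ≤ k := Nat.le_ceil _
  have hk2 : (k:ℝ) < d i / e i + 1 := Nat.ceil_lt_add_one (by positivity)
  rw [div_le_iff₀ he0] at hk1
  have h1 := H 0 (k * e i) (hdX.trans hk1) (d i) (by
    rw [pow_zero, div_one, abs_of_pos hd0]; exact hk1)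
  rw [pow_zero, mul_one] at h1
  have h2 := h.natmul k (e i)
  have h3 : S (d i) ≤ A * (d i / e i + 1) * S (e i) := by
    refine h1.trans ?_
    rw [mul_assoc]
    gcongr
    refine h2.trans ?_
    gcongr
  set p := d i / e i with hp
  have hp0 : 0 < p := by positivity
  have hRp : S (e i) / S (d i) / (e i / d i) = p * (S (e i) / S (d i)) := by
    rw [hp]; field_simp
  rw [hRp] at hlt ⊢
  set y := S (e i) / S (d i) with hy
  have hy0 : 0 < y := by positivity
  have h4 : 1 ≤ A * (p + 1) * y := by
    rw [hy, ← mul_div_assoc, le_div_iff₀ hSd, one_mul]; exact h3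
  nlinarith

lemma cov_bound (h : StdFun S α) (a b : ℝ) (m : ℕ) (hm : 0 < m) :
    |(S a ^ 2 + S b ^ 2 - S (a - b) ^ 2) / 2| ≤ S (m * a) * S b / m + 2 * m * S a ^ 2 := by
  set c := (S a ^ 2 + S b ^ 2 - S (a - b) ^ 2) / 2 with hc
  set g : ℕ → ℝ := fun k => (S (k * a) ^ 2 - S (k * a - b) ^ 2) / 2 with hg
  have hSa := h.nonneg a
  have hdiff : ∀ k < m, |c - (g (k+1) - g k)| ≤ 2 * m * S a ^ 2 := by
    intro k hk
    have h1 := h.cs ((k+1) * a) (k * a) b (b + k * a)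
    have h2 := h.cs ((k+1) * a) (k * a) (k * a) 0
    have e1 : ((k:ℝ)+1) * a - (b + k * a) = a - b := by ring
    have e2 : ((k:ℝ)+1) * a - k * a = a := by ring
    have e3 : (k:ℝ) * a - (b + k * a) = - b := by ring
    have e4 : b - (b + k * a) = - (k * a) := by ring
    rw [e1, e2, e3, e4, h.even, h.even] at h1
    rw [e2, sub_zero, sub_zero, sub_self, h.zero] at h2
    have h3 := h.natmul k a
    have h4 : S (k * a) ≤ m * S a := h3.trans (by gcongr)
    have h5 : S a * S (k * a) ≤ S a * (m * S a) := by gcongr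
    simp only [hg, hc]
    push_cast
    rw [abs_le] at h1 h2 ⊢
    constructor <;> linarith
  have hsum : ∑ k ∈ Finset.range m, (g (k+1) - g k) = g m - g 0 := Finset.sum_range_sub g m
  have hgm : |g m - g 0| ≤ S (m * a) * S b := by
    have h1 := h.cs (m * a) 0 b 0
    simp only [sub_zero, zero_sub, h.even, h.zero] at h1
    simp only [hg, Nat.cast_zero, zero_mul, h.zero, zero_sub, h.even]
    rw [abs_le] at h1 ⊢
    constructor <;> linarith
  have hmc : (m:ℝ) * |c| ≤ S (m * a) * S b + m * (2 * m * S a ^ 2) := by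
    have : (m:ℝ) * c = (g m - g 0) + ∑ k ∈ Finset.range m, (c - (g (k+1) - g k)) := by
      rw [Finset.sum_sub_distrib, hsum]; simp
    have hmm : (m:ℝ) * |c| = |m * c| := by rw [abs_mul, Nat.abs_cast]
    rw [hmm, this]
    refine (abs_add_le _ _).trans ?_
    refine add_le_add hgm ((Finset.abs_sum_le_sum_abs _ _).trans ?_)
    refine (Finset.sum_le_card_nsmul _ _ (2 * m * S a ^ 2) ?_).trans ?_
    · intro k hk; exact hdiff k (Finset.mem_range.mp hk)
    · simp
  have hm0 : (0:ℝ) < m := by exact_mod_cast hm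
  rw [div_add' _ _ _ hm0.ne', le_div_iff₀ hm0]
  linarith

lemma cov_tendsto (h : StdFun S α) {ρ : ℝ} (hρ : 0 ≤ ρ) (hd : Tendsto d l atTop)
    (he : Tendsto e l atTop)
    (hR : Tendsto (fun i => (S (e i) / S (d i)) / (e i / d i)) l (𝓝 ρ)) (t s : ℝ) :
    Tendsto (fun i => (S (d i * t) ^ 2 + S (e i * s) ^ 2 - S (d i * t - e i * s) ^ 2) / 2
      / (S (d i) * S (e i))) l (𝓝 (limCov α ρ t s)) := by
  unfold limCov
  split_ifs with hρ0
  · have hq := h.ratio_tendsto hρ0 hd he hR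
    set κ := ρ ^ (1 / (α - 1)) with hκ
    have hκ0 : 0 < κ := by positivity
    have h1 := h.tendsto_rv hd (tendsto_const_nhds (x := t))
    have h2 := h.tendsto_rv hd (hq.mul_const s)
    have h3 := h.tendsto_rv hd ((hq.mul_const s).const_sub t)
    have h4 := h.tendsto_rv hd hq
    have h5 := ((((h1.pow 2).add (h2.pow 2)).sub (h3.pow 2)).div_const 2).div h4
      (by rw [abs_of_pos hκ0]; positivity)
    have hval : (((|t| ^ α) ^ 2 + (|κ * s| ^ α) ^ 2 - (|t - κ * s| ^ α) ^ 2) / 2 / |κ| ^ α)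
        = (|t| ^ (2 * α) + |κ * s| ^ (2 * α) - |t - κ * s| ^ (2 * α))
          / (2 * ρ ^ (1 / (α - 1) * α)) := by
      rw [Real.rpow_mul hρ, ← hκ, abs_of_pos hκ0, div_div]
      have : ∀ x : ℝ, (|x| ^ α) ^ 2 = |x| ^ (2 * α) := by
        intro x
        rw [← Real.rpow_natCast, ← Real.rpow_mul (abs_nonneg x)]
        congr 1; push_cast; ring
      rw [this, this, this]
    rw [hval] at h5
    refine h5.congr' ?_
    filter_upwards [hd.eventually_gt_atTop 0, he.eventually_gt_atTop 0] with i hi1 hi2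
    have hS := h.pos _ hi1.ne'
    have hS2 := h.pos _ hi2.ne'
    have e1 : d i * (e i / d i * s) = e i * s := by field_simp
    have e2 : d i * (t - e i / d i * s) = d i * t - e i * s := by field_simp
    have e3 : d i * (e i / d i) = e i := by field_simp
    simp only [Pi.div_apply, e1, e2, e3]
    field_simp
  · have hρ0 : ρ = 0 := le_antisymm (not_lt.mp hρ0) hρ
    rw [hρ0] at hR
    have hp := h.ratio_tendsto_zero hd he hR
    have h0 := h.tendsto_zero he hp
    have hα1 := h.hα1
    have hb : ∀ m : ℕ, 0 < m → Tendsto (fun i => S (d i * (m * t)) / S (d i) *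
        (S (e i * s) / S (e i)) / m +
        2 * m * (S (d i * t) / S (d i)) ^ 2 * (S (e i * (d i / e i)) / S (e i))) l
        (𝓝 (|m * t| ^ α * |s| ^ α / m + 2 * m * (|t| ^ α) ^ 2 * 0)) := by
      intro m hm
      have h1 := h.tendsto_rv hd (tendsto_const_nhds (x := t))
      have h2 := h.tendsto_rv hd (tendsto_const_nhds (x := m * t))
      have h3 := h.tendsto_rv he (tendsto_const_nhds (x := s))
      exact ((h2.mul h3).div_const _).add (((h1.pow 2).const_mul _).mul h0)
    rw [Metric.tendsto_nhds]
    intro ε hε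
    have hlim : Tendsto (fun m : ℕ => (m:ℝ) ^ (-(1 - α)) * (|t| ^ α * |s| ^ α)) atTop (𝓝 0) := by
      rw [← zero_mul (|t| ^ α * |s| ^ α)]
      exact ((tendsto_rpow_neg_atTop (by linarith)).comp tendsto_natCast_atTop_atTop).mul_const _
    obtain ⟨m, hm, hm1⟩ := ((hlim.eventually_lt_const hε).and (eventually_gt_atTop 0)).exists
    have hm0 : (0:ℝ) < m := by exact_mod_cast hm1
    have hval : |m * t| ^ α * |s| ^ α / m + 2 * m * (|t| ^ α) ^ 2 * 0 < ε := by
      refine lt_of_eq_of_lt ?_ hm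
      rw [abs_mul, Nat.abs_cast, Real.mul_rpow (by positivity) (by positivity), neg_sub,
        Real.rpow_sub hm0, Real.rpow_one]
      ring
    filter_upwards [hd.eventually_gt_atTop 0, he.eventually_gt_atTop 0,
      (hb m hm1).eventually_lt_const hval] with i hi1 hi2 hi3
    have hS := h.pos _ hi1.ne'
    have hS2 := h.pos _ hi2.ne'
    rw [Real.dist_eq, sub_zero, abs_div, abs_of_pos (mul_pos hS hS2)]
    refine lt_of_le_of_lt ?_ hi3
    rw [div_le_iff₀ (by positivity)]
    refine (h.cov_bound (d i * t) (e i * s) m hm1).trans (le_of_eq ?_)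
    have e1 : e i * (d i / e i) = d i := by field_simp
    rw [e1, show (m:ℝ) * (d i * t) = d i * (m * t) by ring]
    field_simp

end StdFun


lemma IsCenteredGaussian1.fintype {Ω : Type*} [MeasurableSpace Ω] {P : Measure Ω}
    {X : ℝ → Ω → ℝ} {K : ℝ → ℝ → ℝ} (h : IsCenteredGaussian1 P X K)
    {ι : Type*} [Fintype ι] (t c : ι → ℝ) :
    P.map (fun ω => ∑ a, c a * X (t a) ω)
      = gaussianReal 0 (∑ a, ∑ b, c a * c b * K (t a) (t b)).toNNReal := by
  have e := Fintype.equivFin ι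
  have := h.2 (Fintype.card ι) (t ∘ e.symm) (c ∘ e.symm)
  convert this using 2
  · ext ω
    exact (Equiv.sum_comp e.symm (fun a => c a * X (t a) ω)).symm
  · congr 1
    rw [← Equiv.sum_comp e.symm]
    refine Finset.sum_congr rfl fun a _ => ?_
    rw [← Equiv.sum_comp e.symm]
    rfl

lemma incr_law {Ω : Type*} [MeasurableSpace Ω] {P : Measure Ω} {σ : ℝ → ℝ} (hσ0 : σ 0 = 0)
    {J : ℝ → Ω → ℝ} (h : IsCenteredGaussian1 P J (covFromStd σ)) (x y : ℝ) :
    P.map (fun ω => J x ω - J y ω) = gaussianReal 0 (σ |x - y| ^ 2).toNNReal := by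
  have := h.2 2 ![x, y] ![1, -1]
  simp only [Fin.sum_univ_two, Matrix.cons_val_zero, Matrix.cons_val_one, one_mul, neg_mul,
    ← sub_eq_add_neg] at this
  rw [this]
  congr 2
  simp only [covFromStd, sub_self, abs_zero, hσ0, abs_sub_comm y x]
  ring

lemma incr_memLp {Ω : Type*} [MeasurableSpace Ω] {P : Measure Ω} {σ : ℝ → ℝ} (hσ0 : σ 0 = 0)
    {J : ℝ → Ω → ℝ} (h : IsCenteredGaussian1 P J (covFromStd σ)) (x y : ℝ) :
    Integrable (fun ω => (J x ω - J y ω) ^ 2) P ∧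
    ∫ ω, (J x ω - J y ω) ^ 2 ∂P = σ |x - y| ^ 2 := by
  have hl := incr_law hσ0 h x y
  have hm : Measurable (fun ω => J x ω - J y ω) := (h.1 x).sub (h.1 y)
  set v := (σ |x - y| ^ 2).toNNReal with hv
  have hid : MemLp id 2 (gaussianReal 0 v) := memLp_id_gaussianReal' 2 (by simp)
  have h1 : MemLp (fun ω => J x ω - J y ω) 2 P := by
    rw [← hl] at hid
    exact (memLp_map_measure_iff (by fun_prop) hm.aemeasurable).mp hid
  refine ⟨h1.integrable_sq, ?_⟩
  have h2 : ∫ ω, (J x ω - J y ω) ^ 2 ∂P = ∫ z, z ^ 2 ∂(gaussianReal 0 v) := by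
    rw [← hl, integral_map hm.aemeasurable (by fun_prop)]
  rw [h2]
  have h3 : Var[fun z => z; gaussianReal 0 v] = v := variance_fun_id_gaussianReal
  rw [variance_of_integral_eq_zero (by fun_prop) integral_id_gaussianReal] at h3
  rw [h3, hv, Real.coe_toNNReal _ (sq_nonneg _)]

lemma stdFun_of_gauss {Ω : Type*} [MeasurableSpace Ω] (P : Measure Ω) 
    (σ : ℝ → ℝ) (hσcont : ContinuousOn σ (Set.Ici 0)) (hσ0 : σ 0 = 0)
    (hσpos : ∀ t > (0:ℝ), 0 < σ t)
    (J : ℝ → Ω → ℝ) (hJgauss : IsCenteredGaussian1 P J (covFromStd σ))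
    (α : ℝ) (hα : α ∈ Set.Ioo (0:ℝ) 1)
    (hH1 : ∀ t > (0:ℝ), Tendsto (fun x => σ (t * x) / σ x) atTop (𝓝 (t ^ α)))
    (t₀ β C : ℝ) (ht₀ : 0 < t₀) (hβ : β ∈ Set.Ioc (0:ℝ) 1) (hC : 0 < C)
    (hH2 : ∀ t, 0 < t → t < t₀ → σ t ≤ C * t ^ β) : StdFun (fun x => σ |x|) α where
  hα0 := hα.1
  hα1 := hα.2
  cont := hσcont.comp_continuous continuous_abs (fun x => abs_nonneg x)
  zero := by simp [hσ0]
  pos := fun x hx => hσpos _ (abs_pos.mpr hx)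
  even := by simp
  rv := by
    intro t ht
    refine (hH1 t ht).congr' ?_
    filter_upwards [eventually_gt_atTop 0] with x hx
    rw [abs_of_pos hx, abs_of_pos (mul_pos ht hx)]
  holder := ⟨t₀, β, C, ht₀, hβ.1, hC, fun t h1 h2 => by rw [abs_of_pos h1]; exact hH2 t h1 h2⟩
  cs := by
    intro x y z w
    by_cases hxy : x = y
    · subst hxy
      simp only [sub_self, abs_zero, hσ0, mul_zero, zero_mul]
      rw [show ∀ a b : ℝ, a + b - b - a = 0 by intros; ring, abs_zero]
    by_cases hzw : z = w
    · subst hzw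
      simp only [sub_self, abs_zero, hσ0, mul_zero]
      rw [show ∀ a b : ℝ, a + b - a - b = 0 by intros; ring, abs_zero]
    have hf : 0 < σ |x - y| := hσpos _ (abs_pos.mpr (sub_ne_zero.mpr hxy))
    have hg : 0 < σ |z - w| := hσpos _ (abs_pos.mpr (sub_ne_zero.mpr hzw))
    set a := σ |x - y| with ha
    set b := σ |z - w| with hb
    have I := fun p q => (incr_memLp hσ0 hJgauss p q).1
    have V := fun p q => (incr_memLp hσ0 hJgauss p q).2
    have hE : ∫ ω, ((J x ω - J w ω) ^ 2 + (J y ω - J z ω) ^ 2 - (J x ω - J z ω) ^ 2 -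
        (J y ω - J w ω) ^ 2) ∂P = σ |x - w| ^ 2 + σ |y - z| ^ 2 - σ |x - z| ^ 2
          - σ |y - w| ^ 2 := by
      rw [integral_sub, integral_sub, integral_add, V, V, V, V]
      · exact I _ _
      · exact I _ _
      · exact (I _ _).add (I _ _)
      · exact I _ _
      · exact ((I _ _).add (I _ _)).sub (I _ _)
      · exact I _ _
    rw [← hE, ← Real.norm_eq_abs]
    have hB : 2 * a * b = ∫ ω, (b / a * (J x ω - J y ω) ^ 2 + a / b * (J z ω - J w ω) ^ 2) ∂P := by
      rw [integral_add ((I _ _).const_mul _) ((I _ _).const_mul _), integral_const_mul,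
        integral_const_mul, V, V, ← ha, ← hb]
      field_simp
      ring
    rw [hB]
    refine norm_integral_le_of_norm_le (((I _ _).const_mul _).add ((I _ _).const_mul _)) ?_
    refine Eventually.of_forall fun ω => ?_
    rw [Real.norm_eq_abs, show (J x ω - J w ω) ^ 2 + (J y ω - J z ω) ^ 2 - (J x ω - J z ω) ^ 2 -
      (J y ω - J w ω) ^ 2 = 2 * (J x ω - J y ω) * (J z ω - J w ω) by ring]
    set f := J x ω - J y ω
    set g := J z ω - J w ω
    have e : b / a * f ^ 2 + a / b * g ^ 2 = (b ^ 2 * f ^ 2 + a ^ 2 * g ^ 2) / (a * b) := by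
      field_simp
    rw [e, le_div_iff₀ (by positivity), ← abs_of_pos (mul_pos hf hg), ← abs_mul, abs_le]
    constructor
    · nlinarith [sq_nonneg (b * f + a * g)]
    · nlinarith [sq_nonneg (b * f - a * g)]

/-- absolute moments of centered Gaussian laws -/
lemma gauss_moment (p : ℕ) : ∃ c : ℝ, 0 ≤ c ∧ ∀ s : ℝ, 0 ≤ s →
    Integrable (fun x : ℝ => |x| ^ p) (gaussianReal 0 (s ^ 2).toNNReal) ∧
    ∫ x, |x| ^ p ∂(gaussianReal 0 (s ^ 2).toNNReal) = c * s ^ p := by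
  refine ⟨∫ x, |x| ^ p ∂(gaussianReal 0 1), integral_nonneg fun x => by positivity, ?_⟩
  intro s hs
  have hI : ∀ v : NNReal, Integrable (fun x : ℝ => |x| ^ p) (gaussianReal 0 v) := by
    intro v
    have := (memLp_id_gaussianReal' (μ := 0) (v := v) (p : ENNReal) (by simp))
    have := this.integrable_norm_pow'
    simpa using this
  refine ⟨hI _, ?_⟩
  have : gaussianReal 0 (s ^ 2).toNNReal = (gaussianReal 0 1).map (s * ·) := by
    rw [gaussianReal_map_const_mul, mul_zero, mul_one]
    congr 1
    ext
    simp [sq_nonneg]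
  rw [this, integral_map (by fun_prop) (by fun_prop)]
  simp_rw [abs_mul, mul_pow, abs_of_nonneg hs]
  rw [integral_const_mul, mul_comm]

section Interp
variable {E : Type*} [NormedAddCommGroup E] [NormedSpace ℝ E]

/-- hat function at node `j` of the dyadic grid of level `m` of `[-T, T]` -/
def hat (T : ℝ) (m : ℕ) (j : ℕ) (t : ℝ) : ℝ := max 0 (1 - |2 ^ m * ((t + T) / (2 * T)) - j|)

/-- node `j` of the dyadic grid of level `m` of `[-T, T]` -/
def node (T : ℝ) (m : ℕ) (j : ℕ) : ℝ := -T + 2 * T * (j / 2 ^ m)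

lemma hat_continuous (T : ℝ) (m j : ℕ) : Continuous (hat T m j) := by
  unfold hat; fun_prop

lemma hat_nonneg (T : ℝ) (m j : ℕ) (t : ℝ) : 0 ≤ hat T m j t := le_max_left _ _

lemma unit_mem {T : ℝ} (hT : 0 < T) (t : Set.Icc (-T) T) :
    0 ≤ ((t:ℝ) + T) / (2 * T) ∧ ((t:ℝ) + T) / (2 * T) ≤ 1 := by
  obtain ⟨t, h1, h2⟩ := t
  constructor
  · apply div_nonneg <;> simp <;> linarith
  · rw [div_le_one (by linarith)]; simp; linarith

lemma floor_le_pow {x : ℝ} (h1 : x ≤ 1) (m : ℕ) : ⌊2 ^ m * x⌋₊ ≤ 2 ^ m := by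
  apply Nat.floor_le_of_le
  push_cast
  have : (0:ℝ) < 2 ^ m := by positivity
  nlinarith

lemma hat_sum_pos {T : ℝ} (hT : 0 < T) (m : ℕ) (t : Set.Icc (-T) T) :
    0 < ∑ j : Fin (2 ^ m + 1), hat T m j t := by
  obtain ⟨h0, h1⟩ := unit_mem hT t
  set x := ((t:ℝ) + T) / (2 * T) with hx
  apply Finset.sum_pos'
  · intro i _; exact hat_nonneg _ _ _ _
  · refine ⟨⟨⌊2 ^ m * x⌋₊, Nat.lt_succ_of_le (floor_le_pow h1 m)⟩, Finset.mem_univ _, ?_⟩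
    unfold hat
    apply lt_max_of_lt_right
    rw [← hx]
    have h2 : (⌊2 ^ m * x⌋₊ : ℝ) ≤ 2 ^ m * x := Nat.floor_le (by positivity)
    have h3 : 2 ^ m * x < ⌊2 ^ m * x⌋₊ + 1 := Nat.lt_floor_add_one _
    simp only
    rw [abs_of_nonneg (by linarith)]
    linarith

/-- piecewise linear interpolation -/
def interp {T : ℝ} (hT : 0 < T) (m : ℕ) (v : Fin (2 ^ m + 1) → E) : C(Set.Icc (-T) T, E) where
  toFun t := (∑ j : Fin (2 ^ m + 1), hat T m j t)⁻¹ • ∑ j : Fin (2 ^ m + 1), hat T m j t • v j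
  continuous_toFun := by
    have hc := fun j => hat_continuous T m j
    apply Continuous.smul
    · apply Continuous.inv₀
      · fun_prop
      · intro t; exact (hat_sum_pos hT m t).ne'
    · fun_prop

lemma interp_continuous {T : ℝ} (hT : 0 < T) (m : ℕ) :
    Continuous (interp hT m : (Fin (2 ^ m + 1) → E) → _) := by
  apply ContinuousMap.continuous_of_continuous_uncurry
  have hc := fun j => hat_continuous T m j
  simp only [Function.uncurry_def]
  unfold interp
  apply Continuous.smul
  · apply Continuous.inv₀
    · fun_prop
    · intro t; exact (hat_sum_pos hT m t.2).ne'
  · fun_prop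

lemma interp_dist {T : ℝ} (hT : 0 < T) (m : ℕ) (v : Fin (2 ^ m + 1) → E) (t : Set.Icc (-T) T)
    (y : E) (c : ℝ) (h : ∀ j : Fin (2 ^ m + 1),
      |2 ^ m * (((t:ℝ) + T) / (2 * T)) - (j:ℕ)| < 1 → ‖v j - y‖ ≤ c) :
    ‖interp hT m v t - y‖ ≤ c := by
  have hs := hat_sum_pos hT m t
  set s := ∑ j : Fin (2 ^ m + 1), hat T m j t with hsdef
  have e : interp hT m v t - y = s⁻¹ • ∑ j : Fin (2 ^ m + 1), hat T m j t • (v j - y) := by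
    simp_rw [smul_sub, Finset.sum_sub_distrib, ← Finset.sum_smul, ← hsdef]
    rw [smul_sub, inv_smul_smul₀ hs.ne']
    rfl
  rw [e, norm_smul, norm_inv, Real.norm_of_nonneg hs.le, inv_mul_le_iff₀ hs]
  refine (norm_sum_le _ _).trans ?_
  rw [hsdef, Finset.sum_mul]
  apply Finset.sum_le_sum
  intro j _
  rw [norm_smul, Real.norm_of_nonneg (hat_nonneg _ _ _ _)]
  by_cases hj : |2 ^ m * (((t:ℝ) + T) / (2 * T)) - (j:ℕ)| < 1
  · exact mul_le_mul_of_nonneg_left (h j hj) (hat_nonneg _ _ _ _)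
  · have : hat T m j t = 0 := by
      unfold hat; apply max_eq_left; linarith
    rw [this]; simp

lemma node_dist {T : ℝ} (hT : 0 < T) (m j : ℕ) (t : ℝ)
    (h : |2 ^ m * ((t + T) / (2 * T)) - j| ≤ 1) : |node T m j - t| ≤ 2 * T / 2 ^ m := by
  have e : node T m j - t = - ((2 ^ m * ((t + T) / (2 * T)) - j) * (2 * T / 2 ^ m)) := by
    unfold node; field_simp; ring
  rw [e, abs_neg, abs_mul, abs_of_pos (show 0 < 2 * T / 2 ^ m by positivity)]
  have : 0 < 2 * T / 2 ^ m := by positivity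
  nlinarith

/-- restriction of a continuous path to `[-T, T]` -/
def pathOn (T : ℝ) (f : ℝ → E) (hf : Continuous f) : C(Set.Icc (-T) T, E) :=
  ⟨fun t => f t, hf.comp continuous_subtype_val⟩

lemma interp_tendsto {T : ℝ} (hT : 0 < T) (f : ℝ → E) (hf : Continuous f) :
    Tendsto (fun m => interp hT m (fun j => f (node T m j))) atTop (𝓝 (pathOn T f hf)) := by
  rw [Metric.tendsto_atTop]
  intro ε hε
  have huc := (isCompact_Icc (a := -(3 * T)) (b := 3 * T)).uniformContinuousOn_of_continuous
    hf.continuousOn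
  rw [Metric.uniformContinuousOn_iff] at huc
  obtain ⟨η, hη, H⟩ := huc (ε / 2) (by positivity)
  obtain ⟨N, hN⟩ := exists_pow_lt_of_lt_one (show 0 < η / (2 * T) by positivity)
    (show (1/2:ℝ) < 1 by norm_num)
  refine ⟨N, fun m hm => ?_⟩
  refine lt_of_le_of_lt ((ContinuousMap.dist_le (by positivity)).mpr fun t => ?_)
    (show ε / 2 < ε by linarith)
  rw [dist_eq_norm]
  apply interp_dist
  intro j hj
  have h1 := node_dist hT m j t hj.le
  have h2 : 2 * T / 2 ^ m < η := by
    have : (1/2:ℝ) ^ m ≤ (1/2) ^ N := pow_le_pow_of_le_one (by norm_num) (by norm_num) hm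
    have h3 := this.trans_lt hN
    rw [lt_div_iff₀ (by positivity)] at h3
    rw [one_div, inv_pow, mul_comm] at h3
    exact h3
  have h4 : 2 * T / 2 ^ m ≤ 2 * T := div_le_self (by positivity) (one_le_pow₀ (by norm_num))
  have h5 := abs_le.mp (h1.trans h4)
  have h6 := t.2
  rw [← dist_eq_norm]
  apply le_of_lt
  apply H
  · constructor <;> linarith [h6.1, h6.2]
  · constructor <;> linarith [h6.1, h6.2]
  · rw [Real.dist_eq]; exact h1.trans_lt h2

lemma chain_path {T : ℝ} (hT : 0 < T) (f : ℝ → E) (hf : Continuous f) (w : ℕ → ENNReal)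
    (hw : ∀ k, ∀ j < 2 ^ k, edist (f (node T k j)) (f (node T k (j + 1))) ≤ w k)
    (m : ℕ) :
    edist (interp hT m (fun j => f (node T m j))) (pathOn T f hf) ≤ ∑' k, w (m + k) := by
  rw [ContinuousMap.edist_eq_iSup]
  refine iSup_le fun t => ?_
  obtain ⟨h0, h1⟩ := unit_mem hT t
  set x := ((t:ℝ) + T) / (2 * T) with hx
  set a : ℕ → ℕ := fun k => ⌊2 ^ k * x⌋₊ with ha
  have ha1 : ∀ k, (a k : ℝ) ≤ 2 ^ k * x := fun k => Nat.floor_le (by positivity)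
  have ha2 : ∀ k, 2 ^ k * x < a k + 1 := fun k => Nat.lt_floor_add_one _
  have ha3 : ∀ k, a k ≤ 2 ^ k := fun k => floor_le_pow h1 k
  -- first step
  have hA : edist (interp hT m (fun j => f (node T m j)) t) (f (node T m (a m))) ≤ w m := by
    by_cases hwm : w m = ⊤
    · rw [hwm]; exact le_top
    rw [edist_dist, dist_eq_norm]
    apply ENNReal.ofReal_le_of_le_toReal
    apply interp_dist
    intro j hj
    rw [← hx] at hj
    have hj' := abs_lt.mp hj
    have hlt1 : a m < (j:ℕ) + 1 := by
      have : (a m : ℝ) < (j:ℕ) + 1 := by linarith [ha1 m]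
      exact_mod_cast this
    have hlt2 : (j:ℕ) < a m + 2 := by
      have : ((j:ℕ):ℝ) < a m + 2 := by linarith [ha2 m]
      exact_mod_cast this
    have : (j:ℕ) = a m ∨ (j:ℕ) = a m + 1 := by omega
    rcases this with h | h
    · rw [h]; simp
    · rw [h, ← dist_eq_norm, dist_comm]
      have := hw m (a m) (by have := j.2; omega)
      rw [edist_dist] at this
      exact (ENNReal.ofReal_le_iff_le_toReal hwm).mp this
  have hB : edist (f (node T m (a m))) (f t) ≤ ∑' k, w (m + k + 1) := by
    refine edist_le_tsum_of_edist_le_of_tendsto (f := fun k => f (node T k (a k)))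
      (fun k => w (k + 1)) ?_ ?_ m
    · intro k
      have hnode : node T k (a k) = node T (k+1) (2 * a k) := by
        unfold node; push_cast; rw [pow_succ]; field_simp
      have hpow : (2:ℝ) ^ (k+1) * x = 2 * (2 ^ k * x) := by rw [pow_succ]; ring
      have h3 := ha1 (k+1)
      have h4 := ha2 (k+1)
      rw [hpow] at h3 h4
      have hlt1 : a (k+1) < 2 * a k + 2 := by
        have : (a (k+1) : ℝ) < 2 * a k + 2 := by linarith [ha2 k]
        exact_mod_cast this
      have hlt2 : 2 * a k < a (k+1) + 1 := by
        have : 2 * (a k : ℝ) < a (k+1) + 1 := by linarith [ha1 k]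
        exact_mod_cast this
      have : a (k+1) = 2 * a k ∨ a (k+1) = 2 * a k + 1 := by omega
      simp only [Nat.succ_eq_add_one]
      rw [hnode]
      rcases this with h | h
      · rw [h]; simp
      · rw [h]
        exact hw (k+1) (2 * a k) (by have := ha3 (k+1); omega)
    · apply (hf.tendsto _).comp
      rw [tendsto_iff_norm_sub_tendsto_zero]
      refine squeeze_zero (fun _ => norm_nonneg _) (g := fun k => 2 * T * (1/2:ℝ) ^ k) ?_ ?_
      · intro k
        refine (node_dist hT k (a k) t ?_).trans (le_of_eq ?_)
        · rw [← hx, abs_le]; constructor <;> linarith [ha1 k, ha2 k]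
        · rw [one_div, inv_pow]; rfl
      · rw [← mul_zero (2 * T)]
        exact (tendsto_pow_atTop_nhds_zero_of_lt_one (by norm_num) (by norm_num)).const_mul _
  calc _ ≤ w m + ∑' k, w (m + k + 1) := (edist_triangle _ _ _).trans (add_le_add hA hB)
    _ = ∑' k, w (m + k) := by
      exact (tsum_eq_zero_add' (f := fun k => w (m + k)) ENNReal.summable).symm
end Interp


lemma pathOn_measurable {Ω : Type*} [MeasurableSpace Ω] {n : ℕ} {T : ℝ} (hT : 0 < T)
    [MeasurableSpace C(Set.Icc (-T) T, Fin n → ℝ)] [BorelSpace C(Set.Icc (-T) T, Fin n → ℝ)]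
    (X : Ω → ℝ → Fin n → ℝ) (hXc : ∀ ω, Continuous (X ω)) (hXm : ∀ t, Measurable fun ω => X ω t) :
    (∀ m, Measurable fun ω => interp hT m (fun j : Fin (2 ^ m + 1) => X ω (node T m j))) ∧
    Measurable fun ω => pathOn T (X ω) (hXc ω) := by
  have h1 : ∀ m, Measurable fun ω => interp hT m (fun j : Fin (2 ^ m + 1) => X ω (node T m j)) := by
    intro m
    have h2 : Measurable fun ω => (fun j : Fin (2 ^ m + 1) => X ω (node T m j)) :=
      measurable_pi_lambda _ fun j => hXm _
    exact (interp_continuous (E := Fin n → ℝ) hT m).measurable.comp h2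
  refine ⟨h1, measurable_of_tendsto_metrizable h1 ?_⟩
  rw [tendsto_pi_nhds]
  intro ω
  exact interp_tendsto hT (X ω) (hXc ω)

lemma weak_of_fidi_tight {Ω Ω' : Type*} [MeasurableSpace Ω] [MeasurableSpace Ω']
    (P : Measure Ω) (P' : Measure Ω') [IsProbabilityMeasure P] [IsProbabilityMeasure P']
    {n : ℕ} {T : ℝ} (hT : 0 < T) (X : ℝ → Ω → ℝ → Fin n → ℝ) (Y : Ω' → ℝ → Fin n → ℝ)
    (hXc : ∀ u ω, Continuous (X u ω)) (hYc : ∀ ω, Continuous (Y ω))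
    (hXm : ∀ u t, Measurable fun ω => X u ω t) (hYm : ∀ t, Measurable fun ω => Y ω t)
    (fidi : ∀ m : ℕ, ∀ G : BoundedContinuousFunction (Fin (2 ^ m + 1) → Fin n → ℝ) ℝ,
      Tendsto (fun u => ∫ ω, G (fun j => X u ω (node T m j)) ∂P) atTop
        (𝓝 (∫ ω, G (fun j => Y ω (node T m j)) ∂P')))
    (b : ℕ → ENNReal) (hb : ∑' k, b k ≠ ⊤)
    (tight : ∀ᶠ u in atTop, ∃ W : ℕ → Ω → ENNReal, (∀ k, Measurable (W k)) ∧
      (∀ k, ∫⁻ ω, W k ω ∂P ≤ b k) ∧ ∀ ω k, ∀ j < 2 ^ k,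
        edist (X u ω (node T k j)) (X u ω (node T k (j + 1))) ≤ W k ω) :
    TendstoInDistOnCompacts P P' (Set.Icc (-T) T) n X Y := by
  letI : MeasurableSpace C(Set.Icc (-T) T, Fin n → ℝ) := borel _
  haveI : BorelSpace C(Set.Icc (-T) T, Fin n → ℝ) := ⟨rfl⟩
  have mX := fun u => pathOn_measurable hT (X u) (hXc u) (hXm u)
  have mY := pathOn_measurable hT Y hYc hYm
  let μs : ℝ → ProbabilityMeasure C(Set.Icc (-T) T, Fin n → ℝ) := fun u =>
    ⟨P.map (fun ω => pathOn T (X u ω) (hXc u ω)),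
      Measure.isProbabilityMeasure_map (mX u).2.aemeasurable⟩
  let μ : ProbabilityMeasure C(Set.Icc (-T) T, Fin n → ℝ) :=
    ⟨P'.map (fun ω => pathOn T (Y ω) (hYc ω)),
      Measure.isProbabilityMeasure_map mY.2.aemeasurable⟩
  have key : Tendsto μs atTop (𝓝 μ) := by
    rw [tendsto_iff_forall_lipschitz_integral_tendsto]
    rintro f ⟨Cb, hCb⟩ ⟨L, hL⟩
    let f' : BoundedContinuousFunction C(Set.Icc (-T) T, Fin n → ℝ) ℝ :=
      { toFun := f, continuous_toFun := hL.continuous, map_bounded' := ⟨Cb, hCb⟩ }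
    have hfc : Continuous f := hL.continuous
    have e1 : ∀ u, ∫ x, f x ∂(μs u : Measure _) = ∫ ω, f (pathOn T (X u ω) (hXc u ω)) ∂P :=
      fun u => integral_map (mX u).2.aemeasurable hfc.aestronglyMeasurable
    have e2 : ∫ x, f x ∂(μ : Measure _) = ∫ ω, f (pathOn T (Y ω) (hYc ω)) ∂P' :=
      integral_map mY.2.aemeasurable hfc.aestronglyMeasurable
    simp_rw [e1, e2]
    have hbd : ∀ x, ‖f x‖ ≤ ‖f'‖ := fun x => f'.norm_coe_le_norm x
    -- limit side
    have hlim : Tendsto (fun m => ∫ ω, f (interp hT m (fun j => Y ω (node T m j))) ∂P') atTop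
        (𝓝 (∫ ω, f (pathOn T (Y ω) (hYc ω)) ∂P')) := by
      refine tendsto_integral_of_dominated_convergence (fun _ => ‖f'‖) ?_ (integrable_const _) ?_ ?_
      · intro m
        exact (hfc.measurable.comp (mY.1 m)).aestronglyMeasurable
      · intro m; exact .of_forall fun ω => hbd _
      · exact .of_forall fun ω => (hfc.tendsto _).comp (interp_tendsto hT (Y ω) (hYc ω))
    have htail : Tendsto (fun m => (L : ENNReal) * ∑' k, b (m + k)) atTop (𝓝 0) := by
      have := ENNReal.tendsto_sum_nat_add b hb
      have h2 := ENNReal.Tendsto.const_mul this (a := (L : ENNReal)) (Or.inr (by simp))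
      simpa [add_comm] using h2
    have hpre : ∀ m, ∀ᶠ u in atTop,
        edist (∫ ω, f (pathOn T (X u ω) (hXc u ω)) ∂P)
          (∫ ω, f (interp hT m (fun j => X u ω (node T m j))) ∂P) ≤ L * ∑' k, b (m + k) := by
      intro m
      filter_upwards [tight] with u ⟨W, hWm, hWb, hW⟩
      have i1 : Integrable (fun ω => f (pathOn T (X u ω) (hXc u ω))) P :=
        Integrable.of_bound (hfc.measurable.comp (mX u).2).aestronglyMeasurable ‖f'‖
          (.of_forall fun ω => hbd _)
      have i2 : Integrable (fun ω => f (interp hT m (fun j => X u ω (node T m j)))) P :=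
        Integrable.of_bound (hfc.measurable.comp ((mX u).1 m)).aestronglyMeasurable ‖f'‖
          (.of_forall fun ω => hbd _)
      rw [edist_eq_enorm_sub, ← integral_sub i1 i2]
      refine (enorm_integral_le_lintegral_enorm _).trans ?_
      calc _ ≤ ∫⁻ ω, L * ∑' k, W (m + k) ω ∂P := by
            refine lintegral_mono fun ω => ?_
            rw [← edist_eq_enorm_sub]
            refine (hL _ _).trans ?_
            gcongr
            rw [edist_comm]
            exact chain_path hT (X u ω) (hXc u ω) (fun k => W k ω) (hW ω) m
        _ = L * ∑' k, ∫⁻ ω, W (m + k) ω ∂P := by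
            rw [lintegral_const_mul _ (Measurable.ennreal_tsum fun k => hWm _),
              lintegral_tsum fun k => (hWm _).aemeasurable]
        _ ≤ _ := by gcongr; exact hWb _
    have hmid : ∀ m, Tendsto (fun u => ∫ ω, f (interp hT m (fun j => X u ω (node T m j))) ∂P) atTop
        (𝓝 (∫ ω, f (interp hT m (fun j => Y ω (node T m j))) ∂P')) := fun m =>
      fidi m (f'.compContinuous ⟨_, interp_continuous hT m⟩)
    rw [EMetric.tendsto_nhds]
    intro ε hε
    have hε3 : 0 < ε / 3 := ENNReal.div_pos hε.ne' (by simp)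
    obtain ⟨m, hm1, hm2⟩ := ((htail.eventually (gt_mem_nhds hε3)).and
      (EMetric.tendsto_nhds.mp hlim _ hε3)).exists
    filter_upwards [hpre m, EMetric.tendsto_nhds.mp (hmid m) _ hε3] with u h1 h2
    calc _ ≤ _ := edist_triangle4 _ _ _ _
      _ < ε / 3 + ε / 3 + ε / 3 := ENNReal.add_lt_add (ENNReal.add_lt_add (h1.trans_lt hm1) h2) hm2
      _ = ε := ENNReal.add_thirds ε
  intro F
  have hemb : Continuous (ContinuousMap.toUniformOnFunIsCompact :
      C(Set.Icc (-T) T, Fin n → ℝ) → _) :=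
    ContinuousMap.isUniformEmbedding_toUniformOnFunIsCompact.uniformContinuous.continuous
  rw [ProbabilityMeasure.tendsto_iff_forall_integral_tendsto] at key
  have hF := key (F.compContinuous ⟨_, hemb⟩)
  have hc := (F.compContinuous ⟨_, hemb⟩).continuous
  have e1 : ∀ u, ∫ x, (F.compContinuous ⟨_, hemb⟩) x ∂(μs u : Measure _)
      = ∫ ω, (F.compContinuous ⟨_, hemb⟩) (pathOn T (X u ω) (hXc u ω)) ∂P :=
    fun u => integral_map (mX u).2.aemeasurable hc.aestronglyMeasurable
  have e2 : ∫ x, (F.compContinuous ⟨_, hemb⟩) x ∂(μ : Measure _)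
      = ∫ ω, (F.compContinuous ⟨_, hemb⟩) (pathOn T (Y ω) (hYc ω)) ∂P' :=
    integral_map mY.2.aemeasurable hc.aestronglyMeasurable
  simp_rw [e1, e2] at hF
  exact hF


lemma gauss_charFun {Ω : Type*} [MeasurableSpace Ω] {P : Measure Ω}
    {ι : Type*} [Fintype ι] (X : Ω → ι → ℝ) (hX : ∀ a, Measurable fun ω => X ω a)
    (c : EuclideanSpace ℝ ι) (v : ℝ)
    (h : P.map (fun ω => ∑ a, c a * X ω a) = gaussianReal 0 v.toNNReal) :
    charFun (P.map (fun ω => (WithLp.toLp 2 (X ω) : EuclideanSpace ℝ ι))) c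
      = Complex.exp (-((v.toNNReal : ℝ) : ℂ) / 2) := by
  have hm : Measurable (fun ω => (WithLp.toLp 2 (X ω) : EuclideanSpace ℝ ι)) :=
    (WithLp.measurable_toLp 2 _).comp (measurable_pi_lambda _ hX)
  have hm2 : Measurable (fun ω => ∑ a, c a * X ω a) := by
    apply Finset.measurable_sum
    intro a _
    exact (hX a).const_mul _
  have h1 := charFun_gaussianReal (μ := 0) (v := v.toNNReal) 1
  rw [← h, charFun_apply_real, integral_map hm2.aemeasurable (by fun_prop)] at h1
  rw [charFun_apply, integral_map hm.aemeasurable (by fun_prop)]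
  convert h1 using 1
  · refine integral_congr_ae (.of_forall fun ω => ?_)
    simp only [Complex.ofReal_one, one_mul]
    congr 2
  · congr 1; push_cast; ring

lemma gauss_fidi {Ω Ω' : Type*} [MeasurableSpace Ω] [MeasurableSpace Ω']
    (P : Measure Ω) (P' : Measure Ω') [IsProbabilityMeasure P] [IsProbabilityMeasure P']
    {ι : Type*} [Fintype ι] (X : ℝ → Ω → ι → ℝ) (Y : Ω' → ι → ℝ)
    (hX : ∀ u a, Measurable fun ω => X u ω a) (hY : ∀ a, Measurable fun ω => Y ω a)
    (V : ℝ → (ι → ℝ) → ℝ) (V0 : (ι → ℝ) → ℝ)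
    (hXV : ∀ u c, P.map (fun ω => ∑ a, c a * X u ω a) = gaussianReal 0 (V u c).toNNReal)
    (hYV : ∀ c, P'.map (fun ω => ∑ a, c a * Y ω a) = gaussianReal 0 (V0 c).toNNReal)
    (hV : ∀ c, Tendsto (fun u => V u c) atTop (𝓝 (V0 c)))
    (G : BoundedContinuousFunction (ι → ℝ) ℝ) :
    Tendsto (fun u => ∫ ω, G (X u ω) ∂P) atTop (𝓝 (∫ ω, G (Y ω) ∂P')) := by
  rw [tendsto_iff_seq_tendsto]
  intro us hus
  have hmX : ∀ u, Measurable (fun ω => (WithLp.toLp 2 (X u ω) : EuclideanSpace ℝ ι)) := fun u =>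
    (WithLp.measurable_toLp 2 _).comp (measurable_pi_lambda _ (hX u))
  have hmY : Measurable (fun ω => (WithLp.toLp 2 (Y ω) : EuclideanSpace ℝ ι)) :=
    (WithLp.measurable_toLp 2 _).comp (measurable_pi_lambda _ hY)
  let μ : ℕ → ProbabilityMeasure (EuclideanSpace ℝ ι) := fun k =>
    ⟨P.map (fun ω => WithLp.toLp 2 (X (us k) ω)),
      Measure.isProbabilityMeasure_map (hmX _).aemeasurable⟩
  let μ₀ : ProbabilityMeasure (EuclideanSpace ℝ ι) :=
    ⟨P'.map (fun ω => WithLp.toLp 2 (Y ω)), Measure.isProbabilityMeasure_map hmY.aemeasurable⟩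
  have key : Tendsto μ atTop (𝓝 μ₀) := by
    apply ProbabilityMeasure.tendsto_of_tendsto_charFun
    intro c
    have e1 : ∀ k, charFun (μ k : Measure (EuclideanSpace ℝ ι)) c
        = Complex.exp (-(((V (us k) c).toNNReal : ℝ) : ℂ) / 2) := fun k =>
      gauss_charFun _ (hX _) c _ (hXV _ _)
    have e2 : charFun (μ₀ : Measure (EuclideanSpace ℝ ι)) c
        = Complex.exp (-(((V0 c).toNNReal : ℝ) : ℂ) / 2) := gauss_charFun _ hY c _ (hYV _)
    simp_rw [e1, e2]
    have hcont : Continuous fun v : ℝ => Complex.exp (-((v.toNNReal : ℝ) : ℂ) / 2) := by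
      fun_prop
    exact (hcont.tendsto _).comp ((hV c).comp hus)
  rw [ProbabilityMeasure.tendsto_iff_forall_integral_tendsto] at key
  have hG := key (G.compContinuous ⟨WithLp.ofLp, PiLp.continuous_ofLp 2 _⟩)
  have hc := (G.compContinuous ⟨WithLp.ofLp, PiLp.continuous_ofLp 2 (fun _ : ι => ℝ)⟩).continuous
  have e1 : ∀ k, ∫ x, (G.compContinuous ⟨WithLp.ofLp, PiLp.continuous_ofLp 2 (fun _ : ι => ℝ)⟩) x
      ∂(μ k : Measure (EuclideanSpace ℝ ι)) = ∫ ω, G (X (us k) ω) ∂P := fun k =>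
    integral_map (hmX _).aemeasurable hc.aestronglyMeasurable
  have e2 : ∫ x, (G.compContinuous ⟨WithLp.ofLp, PiLp.continuous_ofLp 2 (fun _ : ι => ℝ)⟩) x
      ∂(μ₀ : Measure (EuclideanSpace ℝ ι)) = ∫ ω, G (Y ω) ∂P' :=
    integral_map hmY.aemeasurable hc.aestronglyMeasurable
  simp_rw [e1, e2] at hG
  exact hG


lemma scale_facts {n : ℕ} {σ : ℝ → ℝ} {α : ℝ} (h : StdFun (fun x => σ |x|) α)
    (r : Fin n → ℝ → ℝ) (hrpos : ∀ i, ∀ u > (0:ℝ), 0 < r i u)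
    (hrlim : ∀ i, Tendsto (r i) atTop (𝓝 0))
    (δ : ℝ → ℝ) (hδ : ∀ᶠ x in 𝓝[>] (0:ℝ), 0 < δ x ∧ x * δ x = σ (δ x)) (i : Fin n) :
    (∀ᶠ u in atTop, 0 < δ (r i u) ∧ r i u * δ (r i u) = σ |δ (r i u)| ∧ 0 < r i u ∧
      σ |δ (r i u)| = σ (δ (r i u)) ∧ 0 < σ (δ (r i u))) ∧
    Tendsto (fun u => δ (r i u)) atTop atTop := by
  have h0 : Tendsto (r i) atTop (𝓝[>] 0) :=
    tendsto_nhdsWithin_iff.mpr ⟨hrlim i, (eventually_gt_atTop 0).mono fun u hu => hrpos i u hu⟩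
  have h1 : ∀ᶠ u in atTop, 0 < δ (r i u) ∧ r i u * δ (r i u) = σ |δ (r i u)| ∧ 0 < r i u ∧
      σ |δ (r i u)| = σ (δ (r i u)) ∧ 0 < σ (δ (r i u)) := by
    filter_upwards [h0.eventually hδ, eventually_gt_atTop 0] with u ⟨hu1, hu2⟩ hu3
    have := hrpos i u hu3
    rw [abs_of_pos hu1]
    exact ⟨hu1, hu2, this, rfl, by rw [← hu2]; positivity⟩
  exact ⟨h1, h.tendsto_scale (hrlim i) (h1.mono fun u hu => hu.1) (h1.mono fun u hu => hu.2.1)⟩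

lemma pair_limit {n : ℕ} {σ : ℝ → ℝ} {α : ℝ} (h : StdFun (fun x => σ |x|) α)
    (r : Fin n → ℝ → ℝ) (hrpos : ∀ i, ∀ u > (0:ℝ), 0 < r i u)
    (hrlim : ∀ i, Tendsto (r i) atTop (𝓝 0))
    (ρ : Fin n → Fin n → ℝ)
    (hρmem : ∀ i j, i ≤ j → ρ i j ∈ Set.Icc (0:ℝ) 1)
    (hN3 : ∀ i j, i ≤ j → Tendsto (fun u => r j u / r i u) atTop (𝓝 (ρ i j)))
    (δ : ℝ → ℝ) (hδ : ∀ᶠ x in 𝓝[>] (0:ℝ), 0 < δ x ∧ x * δ x = σ (δ x))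
    (i j : Fin n) (t s : ℝ) :
    Tendsto (fun u => covFromStd σ (δ (r i u) * t) (δ (r j u) * s)
      / (σ (δ (r i u)) * σ (δ (r j u)))) atTop (𝓝 (limCovMat α ρ i j t s)) := by
  have main : ∀ (i j : Fin n) (t s : ℝ), i ≤ j →
      Tendsto (fun u => covFromStd σ (δ (r i u) * t) (δ (r j u) * s)
      / (σ (δ (r i u)) * σ (δ (r j u)))) atTop (𝓝 (limCov α (ρ i j) t s)) := by
    intro i j t s hij
    obtain ⟨hi, hdi⟩ := scale_facts h r hrpos hrlim δ hδ i
    obtain ⟨hj, hdj⟩ := scale_facts h r hrpos hrlim δ hδ j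
    have hR : Tendsto (fun u => ((fun x => σ |x|) (δ (r j u)) / (fun x => σ |x|) (δ (r i u)))
        / (δ (r j u) / δ (r i u))) atTop (𝓝 (ρ i j)) := by
      refine (hN3 i j hij).congr' ?_
      filter_upwards [hi, hj] with u hu hv
      rw [← hu.2.1, ← hv.2.1]
      have := hu.1; have := hv.1; have := hu.2.2.1
      field_simp
    refine (h.cov_tendsto (hρmem i j hij).1 hdi hdj hR t s).congr' ?_
    filter_upwards [hi, hj] with u hu hv
    simp only [covFromStd, hu.2.2.2.1, hv.2.2.2.1]
  unfold limCovMat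
  split_ifs with hij
  · exact main i j t s hij
  · refine (main j i s t (le_of_not_ge hij)).congr fun u => ?_
    rw [mul_comm (σ _)]
    congr 1
    simp only [covFromStd, abs_sub_comm]
    ring

lemma model_fidi {Ω Ω' : Type*} [MeasurableSpace Ω] [MeasurableSpace Ω']
    (P : Measure Ω) (P' : Measure Ω')
    [IsProbabilityMeasure P] [IsProbabilityMeasure P']
    {n : ℕ} {σ : ℝ → ℝ} {α : ℝ} (h : StdFun (fun x => σ |x|) α)
    (J : ℝ → Ω → ℝ) (hJgauss : IsCenteredGaussian1 P J (covFromStd σ))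
    (r : Fin n → ℝ → ℝ) (hrpos : ∀ i, ∀ u > (0:ℝ), 0 < r i u)
    (hrlim : ∀ i, Tendsto (r i) atTop (𝓝 0))
    (ρ : Fin n → Fin n → ℝ)
    (hρmem : ∀ i j, i ≤ j → ρ i j ∈ Set.Icc (0:ℝ) 1)
    (hN3 : ∀ i j, i ≤ j → Tendsto (fun u => r j u / r i u) atTop (𝓝 (ρ i j)))
    (δ : ℝ → ℝ) (hδ : ∀ᶠ x in 𝓝[>] (0:ℝ), 0 < δ x ∧ x * δ x = σ (δ x))
    (B : ℝ → Ω' → Fin n → ℝ)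
    (hBgauss : IsCenteredGaussianVec P' B (limCovMat α ρ))
    (k : ℕ) (t : Fin k → ℝ) (G : BoundedContinuousFunction (Fin k → Fin n → ℝ) ℝ) :
    Tendsto (fun u => ∫ ω, G (fun a i => J (δ (r i u) * t a) ω / σ (δ (r i u))) ∂P) atTop
      (𝓝 (∫ ω, G (fun a i => B (t a) ω i) ∂P')) := by
  have hcurry : Continuous (fun (x : Fin k × Fin n → ℝ) (a : Fin k) (i : Fin n) => x (a, i)) := by
    fun_prop
  refine gauss_fidi P P' (ι := Fin k × Fin n)
    (fun u ω a => J (δ (r a.2 u) * t a.1) ω / σ (δ (r a.2 u)))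
    (fun ω a => B (t a.1) ω a.2) (fun u a => (hJgauss.1 _).div_const _)
    (fun a => hBgauss.1 _ _)
    (fun u c => ∑ a, ∑ b, c a * c b * (covFromStd σ (δ (r a.2 u) * t a.1) (δ (r b.2 u) * t b.1)
      / (σ (δ (r a.2 u)) * σ (δ (r b.2 u)))))
    (fun c => ∑ a, ∑ b, c a * c b * limCovMat α ρ a.2 b.2 (t a.1) (t b.1)) ?_ ?_ ?_
    (G.compContinuous ⟨_, hcurry⟩)
  · intro u c
    have := hJgauss.fintype (ι := Fin k × Fin n) (fun a => δ (r a.2 u) * t a.1)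
      (fun a => c a / σ (δ (r a.2 u)))
    convert this using 2
    · ext ω
      refine Finset.sum_congr rfl fun a _ => ?_
      ring
    · congr 1
      refine Finset.sum_congr rfl fun a _ => Finset.sum_congr rfl fun b _ => ?_
      rw [div_mul_div_comm]
      ring
  · intro c
    have := hBgauss.2 k t (fun a i => c (a, i))
    convert this using 2
    · ext ω
      rw [Fintype.sum_prod_type]
    · congr 1
      rw [Fintype.sum_prod_type]
      refine Finset.sum_congr rfl fun a _ => ?_
      simp_rw [Fintype.sum_prod_type]
      rw [Finset.sum_comm]
  · intro c
    refine tendsto_finsetSum _ fun a _ => tendsto_finsetSum _ fun b _ => ?_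
    exact (pair_limit h r hrpos hrlim ρ hρmem hN3 δ hδ a.2 b.2 _ _).const_mul _


lemma node_sub (T : ℝ) (k j : ℕ) : node T k j - node T k (j + 1) = -(2 * T / 2 ^ k) := by
  unfold node; push_cast; ring

lemma tight_moment {Ω : Type*} [MeasurableSpace Ω] (P : Measure Ω)
    {n : ℕ} {σ : ℝ → ℝ} {α : ℝ} (h : StdFun (fun x => σ |x|) α)
    (J : ℝ → Ω → ℝ) (hJgauss : IsCenteredGaussian1 P J (covFromStd σ))
    (r : Fin n → ℝ → ℝ) (hrpos : ∀ i, ∀ u > (0:ℝ), 0 < r i u)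
    (hrlim : ∀ i, Tendsto (r i) atTop (𝓝 0))
    (δ : ℝ → ℝ) (hδ : ∀ᶠ x in 𝓝[>] (0:ℝ), 0 < δ x ∧ x * δ x = σ (δ x))
    {T : ℝ} (hT : 0 < T) : ∃ q A : ℝ, 0 < q ∧ q < 1 ∧ 0 < A ∧ ∀ p : ℕ, ∃ c : ℝ, 0 ≤ c ∧
      ∀ᶠ u in atTop, ∀ (k j : ℕ) (i : Fin n),
        ∫⁻ ω, ENNReal.ofReal (|J (δ (r i u) * node T k j) ω / σ (δ (r i u))
          - J (δ (r i u) * node T k (j + 1)) ω / σ (δ (r i u))| ^ p) ∂P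
        ≤ ENNReal.ofReal (c * (A * q ^ k) ^ p) := by
  obtain ⟨q, A, X, hq, hq1, hA, hX, H⟩ := h.dyadic
  have hσ0 : σ 0 = 0 := by simpa using h.zero
  set M : ℝ := |2 * T| ^ α + 1 with hM
  have hMpos : 0 < M := by positivity
  refine ⟨q, A * M, hq, hq1, by positivity, fun p => ?_⟩
  obtain ⟨c, hc, hmom⟩ := gauss_moment p
  refine ⟨c, hc, ?_⟩
  have hev : ∀ᶠ u in atTop, ∀ i : Fin n, (0 < δ (r i u) ∧ 0 < σ (δ (r i u)) ∧
      X ≤ δ (r i u) * (2 * T) ∧ σ |δ (r i u) * (2 * T)| ≤ M * σ (δ (r i u))) := by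
    rw [eventually_all]
    intro i
    obtain ⟨hi, hdi⟩ := scale_facts h r hrpos hrlim δ hδ i
    have h1 := h.tendsto_rv hdi (tendsto_const_nhds (x := 2 * T))
    filter_upwards [hi, (hdi.atTop_mul_const (show 0 < 2 * T by positivity)).eventually_ge_atTop X,
      h1.eventually (gt_mem_nhds (show |2 * T| ^ α < M by linarith))] with u hu h2 h3
    refine ⟨hu.1, hu.2.2.2.2, h2, ?_⟩
    simp only [hu.2.2.2.1] at h3
    rw [div_lt_iff₀ hu.2.2.2.2] at h3
    exact h3.le
  filter_upwards [hev] with u hu k j i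
  obtain ⟨hd, hs, hXd, hb⟩ := hu i
  set d := δ (r i u)
  have hm : Measurable (fun ω => J (d * node T k j) ω - J (d * node T k (j + 1)) ω) :=
    (hJgauss.1 _).sub (hJgauss.1 _)
  have hlaw := incr_law hσ0 hJgauss (d * node T k j) (d * node T k (j + 1))
  have e0 : |d * node T k j - d * node T k (j + 1)| = d * (2 * T) / 2 ^ k := by
    rw [← mul_sub, node_sub, mul_neg, abs_neg, abs_of_pos (by positivity)]; ring
  rw [e0] at hlaw
  have e0pos : 0 < d * (2 * T) / 2 ^ k := by positivity
  have hSS := H k (d * (2 * T)) hXd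
  simp only [abs_of_pos e0pos] at hSS
  set s := σ (d * (2 * T) / 2 ^ k) with hsdef
  have hs0 : 0 ≤ s := by
    have := h.nonneg (d * (2 * T) / 2 ^ k)
    simpa only [abs_of_pos e0pos] using this
  obtain ⟨hint, hval⟩ := hmom s hs0
  have hsle : s / σ d ≤ A * M * q ^ k := by
    rw [div_le_iff₀ hs]
    calc s ≤ A * q ^ k * σ |d * (2 * T)| := hSS
      _ ≤ A * q ^ k * (M * σ d) := by gcongr
      _ = _ := by ring
  rw [← hlaw] at hint hval
  have hint' : Integrable (fun ω => |J (d * node T k j) ω - J (d * node T k (j + 1)) ω| ^ p) P :=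
    (integrable_map_measure (by fun_prop) hm.aemeasurable).mp hint
  rw [integral_map hm.aemeasurable (by fun_prop)] at hval
  have hfe : ∀ ω, |J (d * node T k j) ω / σ d - J (d * node T k (j + 1)) ω / σ d| ^ p
      = |J (d * node T k j) ω - J (d * node T k (j + 1)) ω| ^ p * (1 / σ d ^ p) := by
    intro ω
    rw [← sub_div, abs_div, abs_of_pos hs, div_pow]; ring
  simp_rw [hfe]
  rw [← ofReal_integral_eq_lintegral_ofReal (hint'.mul_const _)
    (.of_forall fun ω => by positivity), integral_mul_const, hval]
  apply ENNReal.ofReal_le_ofReal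
  calc c * s ^ p * (1 / σ d ^ p) = c * (s / σ d) ^ p := by rw [div_pow]; ring
    _ ≤ _ := by gcongr

lemma tight_bound {Ω : Type*} [MeasurableSpace Ω] (P : Measure Ω) [IsProbabilityMeasure P]
    {n : ℕ} (X : Ω → ℝ → Fin n → ℝ) (T : ℝ) (hX : ∀ t i, Measurable fun ω => X ω t i)
    {s A c : ℝ} {p : ℕ} (hs : 0 < s) (hA : 0 < A) (hc : 0 ≤ c) (hp : 1 ≤ p)
    (hps : 2 * s ^ p ≤ 1)
    (hmom : ∀ (k j : ℕ) (i : Fin n),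
      ∫⁻ ω, ENNReal.ofReal (|X ω (node T k j) i - X ω (node T k (j + 1)) i| ^ p) ∂P
        ≤ ENNReal.ofReal (c * (A * (s ^ 2) ^ k) ^ p)) :
    ∃ W : ℕ → Ω → ENNReal, (∀ k, Measurable (W k)) ∧
      (∀ k, ∫⁻ ω, W k ω ∂P ≤ ENNReal.ofReal (s ^ k) * (1 + n * ENNReal.ofReal (c * A ^ p))) ∧
      ∀ ω k, ∀ j < 2 ^ k,
        edist (X ω (node T k j)) (X ω (node T k (j + 1))) ≤ W k ω := by
  let D : ℕ → ℕ → Fin n → Ω → ENNReal := fun k j i ω =>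
    ENNReal.ofReal (|X ω (node T k j) i - X ω (node T k (j + 1)) i| ^ p)
  have hD : ∀ k j i, Measurable (D k j i) := by
    intro k j i
    have := ((hX (node T k j) i).sub (hX (node T k (j + 1)) i))
    exact ((continuous_abs.pow p).measurable.comp this).ennreal_ofReal
  let e : ℕ → ENNReal := fun k => ENNReal.ofReal (1 / (s ^ k) ^ p)
  refine ⟨fun k ω => ENNReal.ofReal (s ^ k) *
    (1 + ∑ j ∈ Finset.range (2 ^ k), ∑ i, D k j i ω * e k), ?_, ?_, ?_⟩
  · intro k
    refine Measurable.const_mul (Measurable.const_add ?_ _) _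
    refine Finset.measurable_sum _ fun j _ => Finset.measurable_sum _ fun i _ => ?_
    exact (hD k j i).mul_const _
  · intro k
    have hm1 : ∀ j, Measurable fun ω => ∑ i, D k j i ω * e k := fun j =>
      Finset.measurable_sum _ fun i _ => (hD k j i).mul_const _
    have hm2 : Measurable fun ω => ∑ j ∈ Finset.range (2 ^ k), ∑ i, D k j i ω * e k :=
      Finset.measurable_sum _ fun j _ => hm1 j
    rw [lintegral_const_mul _ (hm2.const_add _), lintegral_add_left measurable_const,
      lintegral_finsetSum _ (fun j _ => hm1 j)]
    gcongr
    · simp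
    calc ∑ j ∈ Finset.range (2 ^ k), ∫⁻ ω, ∑ i, D k j i ω * e k ∂P
        ≤ ∑ j ∈ Finset.range (2 ^ k), ∑ i : Fin n, ENNReal.ofReal (c * A ^ p * (s ^ p) ^ k) := by
          refine Finset.sum_le_sum fun j _ => ?_
          rw [lintegral_finsetSum _ (fun i _ => (hD k j i).mul_const _)]
          refine Finset.sum_le_sum fun i _ => ?_
          rw [lintegral_mul_const _ (hD k j i)]
          refine (mul_le_mul_left (hmom k j i) _).trans ?_
          rw [← ENNReal.ofReal_mul (by positivity)]
          apply ENNReal.ofReal_le_ofReal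
          apply le_of_eq
          rw [mul_pow, ← pow_mul, ← pow_mul, ← pow_mul, ← pow_mul]
          rw [show 2 * (k * p) = k * p + p * k by ring, pow_add]
          field_simp
      _ = n * ENNReal.ofReal ((2 ^ k) * (c * A ^ p * (s ^ p) ^ k)) := by
          rw [ENNReal.ofReal_mul (by positivity : (0:ℝ) ≤ 2 ^ k)]
          rw [Finset.sum_const, Finset.sum_const, Finset.card_range, Finset.card_univ,
            Fintype.card_fin, nsmul_eq_mul, nsmul_eq_mul, ENNReal.ofReal_pow (by norm_num)]
          push_cast
          rw [ENNReal.ofReal_ofNat]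
          ring
      _ ≤ n * ENNReal.ofReal (c * A ^ p) := by
          refine mul_le_mul_right (ENNReal.ofReal_le_ofReal ?_) _
          calc 2 ^ k * (c * A ^ p * (s ^ p) ^ k) = c * A ^ p * (2 * s ^ p) ^ k := by
                rw [mul_pow]; ring
            _ ≤ c * A ^ p * 1 := by
                gcongr
                exact pow_le_one₀ (by positivity) hps
            _ = _ := mul_one _
  · intro ω k j hj
    rw [edist_pi_le_iff]
    intro i
    have hl : 0 < s ^ k := by positivity
    set x := |X ω (node T k j) i - X ω (node T k (j + 1)) i| with hx
    have hx0 : 0 ≤ x := abs_nonneg _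
    have h1 : x ≤ s ^ k * (1 + x ^ p * (1 / (s ^ k) ^ p)) := by
      have hy0 : 0 ≤ x / s ^ k := by positivity
      have : x / s ^ k ≤ 1 + (x / s ^ k) ^ p := by
        rcases le_total (x / s ^ k) 1 with hy | hy
        · have : 0 ≤ (x / s ^ k) ^ p := by positivity
          linarith
        · have := le_self_pow₀ hy (show p ≠ 0 by omega)
          linarith
      rw [div_le_iff₀ hl, div_pow] at this
      calc x ≤ _ := this
        _ = _ := by ring
    rw [edist_dist, Real.dist_eq, ← hx]
    calc ENNReal.ofReal x ≤ ENNReal.ofReal (s ^ k * (1 + x ^ p * (1 / (s ^ k) ^ p))) :=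
          ENNReal.ofReal_le_ofReal h1
      _ = ENNReal.ofReal (s ^ k) * (1 + D k j i ω * e k) := by
          rw [ENNReal.ofReal_mul hl.le, ENNReal.ofReal_add (by norm_num) (by positivity),
            ENNReal.ofReal_mul (by positivity), ENNReal.ofReal_one]
      _ ≤ _ := by
          refine mul_le_mul_right (add_le_add_right ?_ _) _
          refine le_trans ?_ (Finset.single_le_sum
            (f := fun j => ∑ i, D k j i ω * e k) (fun _ _ => zero_le) (Finset.mem_range.mpr hj))
          exact Finset.single_le_sum (f := fun i => D k j i ω * e k)
            (fun _ _ => zero_le) (Finset.mem_univ i)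

/-- **Lemma 3 (heavy traffic).** Under H1, H2, N1–N3 and `r i u → 0`, the scaled
Gaussian input `Jᵟ_u` converges in distribution in `C([−T,T] → ℝⁿ)` to `B_α`, for every
`T > 0`. -/
theorem gauss_convergence_heavy
    {Ω Ω' : Type*} [MeasurableSpace Ω] [MeasurableSpace Ω']
    (P : Measure Ω) (P' : Measure Ω')
    [IsProbabilityMeasure P] [IsProbabilityMeasure P']
    {n : ℕ} (hn : 0 < n)
    -- the Gaussian input process and its standard deviation function
    (σ : ℝ → ℝ) (hσcont : ContinuousOn σ (Set.Ici 0)) (hσ0 : σ 0 = 0)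
    (hσpos : ∀ t > (0:ℝ), 0 < σ t)
    (J : ℝ → Ω → ℝ) (hJcont : ∀ ω, Continuous fun t => J t ω)
    (hJ0 : ∀ ω, J 0 ω = 0)
    (hJgauss : IsCenteredGaussian1 P J (covFromStd σ))
    -- assumption H1
    (α : ℝ) (hα : α ∈ Set.Ioo (0:ℝ) 1)
    (hH1 : ∀ t > (0:ℝ), Tendsto (fun x => σ (t * x) / σ x) atTop (𝓝 (t ^ α)))
    -- assumption H2
    (t₀ β C : ℝ) (ht₀ : 0 < t₀) (hβ : β ∈ Set.Ioc (0:ℝ) 1) (hC : 0 < C)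
    (hH2 : ∀ t, 0 < t → t < t₀ → σ t ≤ C * t ^ β)
    -- the routing matrix: strictly upper triangular, nonnegative entries,
    -- at most one positive entry per column
    (Pm : Matrix (Fin n) (Fin n) ℝ)
    (hPnn : ∀ i j, 0 ≤ Pm i j)
    (hPut : ∀ i j, j ≤ i → Pm i j = 0)
    (hPcol : ∀ j i i', 0 < Pm i j → 0 < Pm i' j → i = i')
    -- output rates: positive, monotone in u, tending to 0 (heavy traffic)
    (r : Fin n → ℝ → ℝ)
    (hrpos : ∀ i, ∀ u > (0:ℝ), 0 < r i u)
    (hrmono : ∀ i, Monotone (r i) ∨ Antitone (r i))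
    (hrlim : ∀ i, Tendsto (r i) atTop (𝓝 0))
    -- assumption N1
    (hN1 : ∀ i j, 0 < Pm i j → ∀ u > (0:ℝ), r j u < Pm i j * r i u)
    -- assumption N3
    (ρ : Fin n → Fin n → ℝ)
    (hρmem : ∀ i j, i ≤ j → ρ i j ∈ Set.Icc (0:ℝ) 1)
    (hN3 : ∀ i j, i ≤ j → Tendsto (fun u => r j u / r i u) atTop (𝓝 (ρ i j)))
    -- the scaling function δ, solving x δ(x) = σ(δ(x)) near 0
    (δ : ℝ → ℝ) (hδ : ∀ᶠ x in 𝓝[>] (0:ℝ), 0 < δ x ∧ x * δ x = σ (δ x))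
    -- the limiting n-dimensional Gaussian process B_α
    (B : ℝ → Ω' → Fin n → ℝ)
    (hBcont : ∀ ω i, Continuous fun t => B t ω i)
    (hBgauss : IsCenteredGaussianVec P' B (limCovMat α ρ)) :
    -- conclusion: Jᵟ_u → B_α in distribution in C([−T,T] → ℝⁿ), for every T > 0
    ∀ T > (0:ℝ),
      TendstoInDistOnCompacts P P' (Set.Icc (-T) T) n
        (fun u ω t i => J (δ (r i u) * t) ω / σ (δ (r i u)))
        (fun ω t i => B t ω i) := by
  intro T hT
  have h := stdFun_of_gauss P σ hσcont hσ0 hσpos J hJgauss α hα hH1 t₀ β C ht₀ hβ hC hH2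
  obtain ⟨q, A, hq, hq1, hA, hmom⟩ := tight_moment P h J hJgauss r hrpos hrlim δ hδ hT
  set s := Real.sqrt q with hs
  have hs0 : 0 < s := Real.sqrt_pos.mpr hq
  have hs1 : s < 1 := by
    rw [hs, Real.sqrt_lt' one_pos]; simpa using hq1
  have hss : s ^ 2 = q := Real.sq_sqrt hq.le
  obtain ⟨p0, hp0⟩ := exists_pow_lt_of_lt_one (show (0:ℝ) < 1 / 2 by norm_num) hs1
  have hp : 2 * s ^ (p0 + 1) ≤ 1 := by
    have : s ^ (p0 + 1) ≤ s ^ p0 := pow_le_pow_of_le_one hs0.le hs1.le (Nat.le_succ _)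
    linarith
  obtain ⟨c, hc, hev⟩ := hmom (p0 + 1)
  have hXm : ∀ u t i, Measurable fun ω => J (δ (r i u) * t) ω / σ (δ (r i u)) :=
    fun u t i => (hJgauss.1 _).div_const _
  refine weak_of_fidi_tight P P' hT _ _ ?_ ?_ ?_ ?_ ?_
    (fun k => ENNReal.ofReal (s ^ k) * (1 + n * ENNReal.ofReal (c * A ^ (p0 + 1)))) ?_ ?_
  · intro u ω
    refine continuous_pi fun i => ?_
    exact ((hJcont ω).comp (continuous_const_mul _)).div_const _
  · intro ω
    exact continuous_pi fun i => hBcont ω i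
  · intro u t
    exact measurable_pi_lambda _ fun i => hXm u t i
  · intro t
    exact measurable_pi_lambda _ fun i => hBgauss.1 t i
  · intro m G
    exact model_fidi P P' h J hJgauss r hrpos hrlim ρ hρmem hN3 δ hδ B hBgauss (2 ^ m + 1)
      (fun j => node T m j) G
  · rw [ENNReal.tsum_mul_right]
    refine ENNReal.mul_ne_top ?_ (by finiteness)
    rw [← ENNReal.ofReal_tsum_of_nonneg (fun k => by positivity)
      (summable_geometric_of_lt_one hs0.le hs1)]
    exact ENNReal.ofReal_ne_top
  · filter_upwards [hev] with u hu
    rw [← hss] at hu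
    exact tight_bound P (fun ω t i => J (δ (r i u) * t) ω / σ (δ (r i u))) T (hXm u) hs0 hA hc
      (Nat.le_add_left 1 p0) hp hu
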